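/- arXiv:1701.04841 — 3 statements merged into one kernel-verified Lean document; each statement's English description precedes it below -/
import Mathlib

section
/- Let ρ⁰ ∈ P_o(G), let ρ∞ ∈ P_o(G) be a Gibbs measure, and let ρ : [0,∞) → P_o(G) be a continuously differentiable solution of the Fokker–Planck equation dρ/dt = −L(ρ)F(ρ) with ρ(0) = ρ⁰. Assume there is λ > 0 with Hess𝓕(σ) ⪰ λ·I for all σ ∈ P_o(G), and h₁ > 0 with ‖Hess𝓕(σ)‖₁ ≤ h₁ (maximum absolute column sum norm) for all σ ∈ P(G) satisfying σ_i ≥ min(m(ρ⁰), min_j ρ∞_j) for every i. Set r = √2 · Deg(G) · max_{(i,j)∈E} ω_{ij} · (h₁/λ^{3/2}) · ((1−m(ρ⁰))/m(ρ⁰)²) · (λ_max(L̂)/λ_sec(L̂)²) · √(𝓕(ρ⁰)−𝓕(ρ∞)) and C = 2·m(ρ⁰)·λ_sec(L̂)·λ/(r+1)². Then for all t ≥ 0, 𝓕(ρ(t)) − 𝓕(ρ∞) ≤ e^{−Ct}·(𝓕(ρ⁰) − 𝓕(ρ∞)). -/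
open Finset Filter Matrix
open scoped Classical

noncomputable section

namespace FPEGraph

variable {n : ℕ}

/-- Edge average `θ_{ij}(ρ) = (ρ_i + ρ_j)/2`. -/
def theta (ρ : Fin n → ℝ) (i j : Fin n) : ℝ := (ρ i + ρ j) / 2

/-- Weighted graph Laplacian `L(ρ)`, satisfying
`(L(ρ)Φ)_i = ∑_{j} ω_{ij} θ_{ij}(ρ) (Φ_i - Φ_j)` (the sum over all `j` equals the
sum over neighbors since `ω_{ij} = 0` off edges). -/
def Lmat (ω : Fin n → Fin n → ℝ) (ρ : Fin n → ℝ) : Matrix (Fin n) (Fin n) ℝ :=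
  fun i j => if i = j then ∑ k, ω i k * theta ρ i k else -(ω i j * theta ρ i j)

/-- Graph Laplacian `L̂`, with `(L̂Φ)_i = ∑_{j} ω_{ij} (Φ_i - Φ_j)`. -/
def Lhat (ω : Fin n → Fin n → ℝ) : Matrix (Fin n) (Fin n) ℝ :=
  fun i j => if i = j then ∑ k, ω i k else -(ω i j)

/-- Connectivity of the weighted graph: any two vertices are joined by a chain of edges. -/
def Conn (ω : Fin n → Fin n → ℝ) : Prop :=
  ∀ i j : Fin n, Relation.ReflTransGen (fun a b => ω a b ≠ 0) i j

/-- `ω` encodes a connected undirected weighted graph without self-loops: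
symmetric nonnegative weights, zero diagonal, connected (edges are pairs with `ω_{ij} > 0`,
i.e. `ω_{ij} ≠ 0`). -/
def IsGraph (ω : Fin n → Fin n → ℝ) : Prop :=
  (∀ i j, ω i j = ω j i) ∧ (∀ i, ω i i = 0) ∧ (∀ i j, 0 ≤ ω i j) ∧ Conn ω

/-- The probability simplex `P(G)`. -/
def PG (ρ : Fin n → ℝ) : Prop := (∑ i, ρ i) = 1 ∧ ∀ i, 0 ≤ ρ i

/-- The interior `P_o(G)` of the probability simplex. -/
def PoG (ρ : Fin n → ℝ) : Prop := (∑ i, ρ i) = 1 ∧ ∀ i, 0 < ρ i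

/-- Free energy `𝓕(ρ) = (1/2) ρᵀ𝕎ρ + 𝕍ᵀρ + β ∑ᵢ ρᵢ log ρᵢ`. -/
def freeEnergy (W : Matrix (Fin n) (Fin n) ℝ) (V : Fin n → ℝ) (β : ℝ) (ρ : Fin n → ℝ) : ℝ :=
  (1/2) * (ρ ⬝ᵥ W.mulVec ρ) + V ⬝ᵥ ρ + β * ∑ i, ρ i * Real.log (ρ i)

/-- Gradient `F(ρ)` of the free energy, `F_i(ρ) = 𝕍_i + (𝕎ρ)_i + β log ρ_i + β`. -/
def gradF (W : Matrix (Fin n) (Fin n) ℝ) (V : Fin n → ℝ) (β : ℝ) (ρ : Fin n → ℝ) :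
    Fin n → ℝ :=
  fun i => V i + W.mulVec ρ i + β * Real.log (ρ i) + β

/-- Hessian `Hess𝓕(ρ) = 𝕎 + β diag(1/ρ₁, …, 1/ρₙ)`. -/
def hessF (W : Matrix (Fin n) (Fin n) ℝ) (β : ℝ) (ρ : Fin n → ℝ) :
    Matrix (Fin n) (Fin n) ℝ :=
  W + β • Matrix.diagonal (fun i => (ρ i)⁻¹)

/-- Gibbs measure: `ρ∞ ∈ P_o(G)` with `ρ∞_i = e^{-((𝕎ρ∞)_i + 𝕍_i)/β} / K`. -/
def IsGibbs (W : Matrix (Fin n) (Fin n) ℝ) (V : Fin n → ℝ) (β : ℝ) (ρ : Fin n → ℝ) : Prop :=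
  PoG ρ ∧ ∀ i, ρ i = Real.exp (-(W.mulVec ρ i + V i) / β) /
      ∑ j, Real.exp (-(W.mulVec ρ j + V j) / β)

/-- A continuously differentiable solution `ρ : [0,∞) → P_o(G)` of the Fokker–Planck
equation `ρ' = -L(ρ)F(ρ)`. -/
def IsSolution (ω : Fin n → Fin n → ℝ) (W : Matrix (Fin n) (Fin n) ℝ) (V : Fin n → ℝ)
    (β : ℝ) (ρ : ℝ → Fin n → ℝ) : Prop :=
  (∀ t ∈ Set.Ici (0:ℝ), PoG (ρ t)) ∧
  ∀ t ∈ Set.Ici (0:ℝ),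
    HasDerivWithinAt ρ (-(Lmat ω (ρ t)).mulVec (gradF W V β (ρ t))) (Set.Ici 0) t

/-- `M = e^{2 max_{i,j}(|𝕍_i| + |𝕎_{ij}|)}`. -/
def Mconst (W : Matrix (Fin n) (Fin n) ℝ) (V : Fin n → ℝ) : ℝ :=
  Real.exp (2 * ⨆ i : Fin n, ⨆ j : Fin n, (|V i| + |W i j|))

/-- `m(ρ⁰) = (1/2) (1/(1+(2M)^{1/β}))^{n-2} min{1/(1+(2M)^{1/β}), minᵢ ρ⁰ᵢ}`. -/
def mconst (W : Matrix (Fin n) (Fin n) ℝ) (V : Fin n → ℝ) (β : ℝ) (ρ0 : Fin n → ℝ) : ℝ :=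
  (1/2) * (1 / (1 + (2 * Mconst W V) ^ (1/β)))^(n-2) *
    min (1 / (1 + (2 * Mconst W V) ^ (1/β))) (⨅ i, ρ0 i)

/-- Second smallest eigenvalue (via the Rayleigh quotient on the orthogonal complement of
the constants; for the symmetric PSD Laplacians considered here, whose kernel is spanned by
the constant vector, this is exactly the second-smallest eigenvalue with multiplicity). -/
def lamSec (A : Matrix (Fin n) (Fin n) ℝ) : ℝ :=
  sInf {x | ∃ Φ : Fin n → ℝ, (∑ i, Φ i) = 0 ∧ (∑ i, (Φ i)^2) = 1 ∧ x = Φ ⬝ᵥ A.mulVec Φ}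

/-- Largest eigenvalue of a symmetric matrix, via the Rayleigh quotient. -/
def lamMax (A : Matrix (Fin n) (Fin n) ℝ) : ℝ :=
  sSup {x | ∃ Φ : Fin n → ℝ, (∑ i, (Φ i)^2) = 1 ∧ x = Φ ⬝ᵥ A.mulVec Φ}

/-- Maximum absolute column sum norm `‖A‖₁`. -/
def matNorm1 (A : Matrix (Fin n) (Fin n) ℝ) : ℝ := ⨆ j : Fin n, ∑ i, |A i j|

/-- Maximal vertex degree `Deg(G)`. -/
def maxDeg (ω : Fin n → Fin n → ℝ) : ℕ :=
  Finset.univ.sup fun i => (Finset.univ.filter fun j => ω i j ≠ 0).card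

/-- Maximal edge weight `max_{(i,j)∈E} ω_{ij}` (equal to the max over all pairs since
`ω = 0` off edges and weights are positive on edges). -/
def maxWeight (ω : Fin n → Fin n → ℝ) : ℝ := ⨆ i : Fin n, ⨆ j : Fin n, ω i j

/-- A vector field on `G`: a skew-symmetric matrix vanishing off edges. -/
def IsVF (ω : Fin n → Fin n → ℝ) (v : Fin n → Fin n → ℝ) : Prop :=
  (∀ i j, v i j = - v j i) ∧ ∀ i j, ω i j = 0 → v i j = 0

/-- Potential vector field `(∇_G Φ)_{ij} = √ω_{ij} (Φ_i - Φ_j)` (this vanishes off edges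
since `ω_{ij} = 0` there). -/
def gradG (ω : Fin n → Fin n → ℝ) (Φ : Fin n → ℝ) : Fin n → Fin n → ℝ :=
  fun i j => Real.sqrt (ω i j) * (Φ i - Φ j)

/-- Divergence `div_G(ρv)_i = -∑_j √ω_{ij} v_{ij} θ_{ij}(ρ)` (sum over all `j` equals the
sum over neighbors since `√ω_{ij} = 0` off edges). -/
def divG (ω : Fin n → Fin n → ℝ) (ρ : Fin n → ℝ) (v : Fin n → Fin n → ℝ) : Fin n → ℝ :=
  fun i => -∑ j, Real.sqrt (ω i j) * v i j * theta ρ i j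

/-- Inner product `(v,w)_ρ = (1/2) ∑_{(i,j)∈E} v_{ij} w_{ij} θ_{ij}(ρ)`. -/
def innerG (ω : Fin n → Fin n → ℝ) (ρ : Fin n → ℝ) (v w : Fin n → Fin n → ℝ) : ℝ :=
  (1/2) * ∑ i, ∑ j, if ω i j ≠ 0 then v i j * w i j * theta ρ i j else 0


theorem Lmat_eq_Lhat (ω : Fin n → Fin n → ℝ) (ρ : Fin n → ℝ) :
    Lmat ω ρ = Lhat fun i j => ω i j * theta ρ i j := rfl

theorem theta_comm (ρ : Fin n → ℝ) (i j : Fin n) : theta ρ i j = theta ρ j i := by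
  unfold theta; ring

theorem Lhat_mulVec {w : Fin n → Fin n → ℝ} (hw : ∀ i, w i i = 0) (Φ : Fin n → ℝ) (i : Fin n) :
    (Lhat w).mulVec Φ i = ∑ j, w i j * (Φ i - Φ j) := by
  have h : ∀ j, Lhat w i j * Φ j = (if i = j then (∑ k, w i k) * Φ j else 0) - w i j * Φ j := by
    intro j
    unfold Lhat
    split_ifs with hij
    · subst hij; rw [hw i]; ring
    · ring
  simp only [Matrix.mulVec, dotProduct, h, Finset.sum_sub_distrib, Finset.sum_ite_eq,
    Finset.mem_univ, if_true, mul_sub, Finset.sum_mul]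

theorem dotProduct_Lhat_mulVec {w : Fin n → Fin n → ℝ} (hw : ∀ i, w i i = 0)
    (hs : ∀ i j, w i j = w j i) (Φ : Fin n → ℝ) :
    Φ ⬝ᵥ (Lhat w).mulVec Φ = (1 / 2) * ∑ i, ∑ j, w i j * (Φ i - Φ j) ^ 2 := by
  have h1 : Φ ⬝ᵥ (Lhat w).mulVec Φ = ∑ i, ∑ j, Φ i * (w i j * (Φ i - Φ j)) := by
    simp only [dotProduct, Lhat_mulVec hw, Finset.mul_sum]
  have h2 : Φ ⬝ᵥ (Lhat w).mulVec Φ = ∑ i, ∑ j, Φ j * (w i j * (Φ j - Φ i)) := by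
    rw [h1, Finset.sum_comm]
    refine Finset.sum_congr rfl fun i _ => Finset.sum_congr rfl fun j _ => ?_
    rw [hs]
  have h3 : ∑ i, ∑ j, w i j * (Φ i - Φ j) ^ 2
      = (∑ i, ∑ j, Φ i * (w i j * (Φ i - Φ j))) + ∑ i, ∑ j, Φ j * (w i j * (Φ j - Φ i)) := by
    simp only [← Finset.sum_add_distrib]
    refine Finset.sum_congr rfl fun i _ => Finset.sum_congr rfl fun j _ => ?_
    ring
  rw [h3, ← h1, ← h2]; ring

/-- The flux of `-L Φ` into a vertex set comes only from edges crossing its boundary. -/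
theorem sum_neg_Lhat_mulVec {w : Fin n → Fin n → ℝ} (hw : ∀ i, w i i = 0)
    (hs : ∀ i j, w i j = w j i) (Φ : Fin n → ℝ) (B : Finset (Fin n)) :
    ∑ j ∈ B, (-(Lhat w).mulVec Φ) j = ∑ j ∈ B, ∑ i ∈ Bᶜ, w j i * (Φ i - Φ j) := by
  have h0 : ∑ j ∈ B, ∑ i ∈ B, w j i * (Φ i - Φ j) = 0 := by
    have h : ∑ j ∈ B, ∑ i ∈ B, w j i * (Φ i - Φ j)
        = -∑ j ∈ B, ∑ i ∈ B, w j i * (Φ i - Φ j) := by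
      conv_lhs => rw [Finset.sum_comm]
      simp only [← Finset.sum_neg_distrib]
      refine Finset.sum_congr rfl fun i _ => Finset.sum_congr rfl fun j _ => ?_
      rw [hs]; ring
    linarith
  have h1 : ∀ j, (-(Lhat w).mulVec Φ) j
      = ∑ i ∈ B, w j i * (Φ i - Φ j) + ∑ i ∈ Bᶜ, w j i * (Φ i - Φ j) := by
    intro j
    rw [Finset.sum_add_sum_compl, Pi.neg_apply, Lhat_mulVec hw, ← Finset.sum_neg_distrib]
    exact Finset.sum_congr rfl fun i _ => by ring
  simp only [h1, Finset.sum_add_distrib, h0, zero_add]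

theorem Conn.exists_crossing_edge {ω : Fin n → Fin n → ℝ} (h : Conn ω) {B : Finset (Fin n)}
    {a b : Fin n} (ha : a ∈ B) (hb : b ∉ B) : ∃ j ∈ B, ∃ i ∉ B, ω j i ≠ 0 := by
  by_contra! hc
  have : ∀ c, Relation.ReflTransGen (fun a b => ω a b ≠ 0) a c → c ∈ B := by
    intro c hac
    induction hac with
    | refl => exact ha
    | tail _ hxy ih =>
      by_contra hy
      exact hxy (hc _ ih _ hy)
  exact hb (this b (h a b))

theorem lamSec_nonneg {w : Fin n → Fin n → ℝ} (hw : ∀ i, w i i = 0)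
    (hs : ∀ i j, w i j = w j i) (hp : ∀ i j, 0 ≤ w i j) : 0 ≤ lamSec (Lhat w) := by
  refine Real.sInf_nonneg ?_
  rintro x ⟨Φ, -, -, rfl⟩
  rw [dotProduct_Lhat_mulVec hw hs]
  exact mul_nonneg (by norm_num) (Finset.sum_nonneg fun i _ => Finset.sum_nonneg fun j _ =>
    mul_nonneg (hp i j) (sq_nonneg _))

theorem lamMax_nonneg {w : Fin n → Fin n → ℝ} (hw : ∀ i, w i i = 0)
    (hs : ∀ i j, w i j = w j i) (hp : ∀ i j, 0 ≤ w i j) : 0 ≤ lamMax (Lhat w) := by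
  refine Real.sSup_nonneg ?_
  rintro x ⟨Φ, -, rfl⟩
  rw [dotProduct_Lhat_mulVec hw hs]
  exact mul_nonneg (by norm_num) (Finset.sum_nonneg fun i _ => Finset.sum_nonneg fun j _ =>
    mul_nonneg (hp i j) (sq_nonneg _))

/-- Poincaré inequality for the graph Laplacian. -/
theorem lamSec_mul_le {w : Fin n → Fin n → ℝ} (hw : ∀ i, w i i = 0)
    (hs : ∀ i j, w i j = w j i) (hp : ∀ i j, 0 ≤ w i j) {Φ : Fin n → ℝ} (hΦ : ∑ i, Φ i = 0) :
    lamSec (Lhat w) * ∑ i, Φ i ^ 2 ≤ Φ ⬝ᵥ (Lhat w).mulVec Φ := by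
  have hN : 0 ≤ ∑ i, Φ i ^ 2 := Finset.sum_nonneg fun i _ => sq_nonneg _
  have hq : ∀ Ψ : Fin n → ℝ, 0 ≤ Ψ ⬝ᵥ (Lhat w).mulVec Ψ := by
    intro Ψ
    rw [dotProduct_Lhat_mulVec hw hs]
    exact mul_nonneg (by norm_num) (Finset.sum_nonneg fun i _ => Finset.sum_nonneg fun j _ =>
      mul_nonneg (hp i j) (sq_nonneg _))
  rcases hN.eq_or_lt with h0 | h0
  · rw [← h0, mul_zero]; exact hq Φ
  · set c := Real.sqrt (∑ i, Φ i ^ 2) with hc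
    have hc2 : c ^ 2 = ∑ i, Φ i ^ 2 := Real.sq_sqrt hN
    have hcpos : 0 < c := Real.sqrt_pos.2 h0
    have hmem : lamSec (Lhat w) ≤ (c⁻¹ • Φ) ⬝ᵥ (Lhat w).mulVec (c⁻¹ • Φ) := by
      refine csInf_le ⟨0, ?_⟩ ⟨c⁻¹ • Φ, ?_, ?_, rfl⟩
      · rintro x ⟨Ψ, -, -, rfl⟩
        exact hq Ψ
      · simp only [Pi.smul_apply, smul_eq_mul, ← Finset.mul_sum, hΦ, mul_zero]
      · simp only [Pi.smul_apply, smul_eq_mul, mul_pow, ← Finset.mul_sum, ← hc2]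
        field_simp
    rw [Matrix.mulVec_smul, dotProduct_smul, smul_dotProduct, smul_eq_mul, smul_eq_mul] at hmem
    rw [← hc2]
    calc lamSec (Lhat w) * c ^ 2 ≤ (c⁻¹ * (c⁻¹ * (Φ ⬝ᵥ (Lhat w).mulVec Φ))) * c ^ 2 := by gcongr
      _ = Φ ⬝ᵥ (Lhat w).mulVec Φ := by field_simp

theorem hasDerivWithinAt_apply {γ : ℝ → Fin n → ℝ} {γ' : Fin n → ℝ} {s : Set ℝ} {t : ℝ}
    (h : HasDerivWithinAt γ γ' s t) (i : Fin n) :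
    HasDerivWithinAt (fun u => γ u i) (γ' i) s t :=
  hasDerivWithinAt_pi.1 h i

theorem hasDerivWithinAt_mulVec (W : Matrix (Fin n) (Fin n) ℝ)
    {γ : ℝ → Fin n → ℝ} {γ' : Fin n → ℝ} {s : Set ℝ} {t : ℝ}
    (h : HasDerivWithinAt γ γ' s t) (i : Fin n) :
    HasDerivWithinAt (fun u => W.mulVec (γ u) i) (W.mulVec γ' i) s t := by
  simp only [Matrix.mulVec, dotProduct]
  exact HasDerivWithinAt.fun_sum fun j _ => (hasDerivWithinAt_apply h j).const_mul (W i j)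

/-- Chain rule for the free energy along a curve of positive densities. -/
theorem hasDerivWithinAt_freeEnergy {W : Matrix (Fin n) (Fin n) ℝ} (hW : W.IsSymm)
    (V : Fin n → ℝ) (β : ℝ) {γ : ℝ → Fin n → ℝ} {γ' : Fin n → ℝ} {s : Set ℝ} {t : ℝ}
    (h : HasDerivWithinAt γ γ' s t) (hpos : ∀ i, 0 < γ t i) :
    HasDerivWithinAt (fun u => freeEnergy W V β (γ u)) (gradF W V β (γ t) ⬝ᵥ γ') s t := by
  have hc := hasDerivWithinAt_apply h
  have h1 : HasDerivWithinAt (fun u => γ u ⬝ᵥ W.mulVec (γ u))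
      (∑ i, (γ' i * W.mulVec (γ t) i + γ t i * W.mulVec γ' i)) s t :=
    HasDerivWithinAt.fun_sum fun i _ => (hc i).fun_mul (hasDerivWithinAt_mulVec W h i)
  have h2 : HasDerivWithinAt (fun u => V ⬝ᵥ γ u) (∑ i, V i * γ' i) s t :=
    HasDerivWithinAt.fun_sum fun i _ => (hc i).const_mul (V i)
  have h3 : HasDerivWithinAt (fun u => ∑ i, γ u i * Real.log (γ u i))
      (∑ i, (γ' i * Real.log (γ t i) + γ t i * (γ' i / γ t i))) s t :=
    HasDerivWithinAt.fun_sum fun i _ => (hc i).fun_mul ((hc i).log (hpos i).ne')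
  have hsymm : ∑ i, γ t i * W.mulVec γ' i = ∑ i, γ' i * W.mulVec (γ t) i := by
    change γ t ⬝ᵥ W.mulVec γ' = γ' ⬝ᵥ W.mulVec (γ t)
    rw [dotProduct_comm γ', Matrix.dotProduct_mulVec, ← Matrix.mulVec_transpose, hW.eq]
  refine (((h1.const_mul (1 / 2)).fun_add h2).fun_add (h3.const_mul β)).congr_deriv ?_
  rw [Finset.sum_add_distrib, hsymm]
  simp only [dotProduct, gradF, Finset.mul_sum, ← Finset.sum_add_distrib]
  refine Finset.sum_congr rfl fun i _ => ?_
  have := (hpos i).ne'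
  field_simp
  ring

theorem hasDerivWithinAt_gradF_dotProduct (W : Matrix (Fin n) (Fin n) ℝ)
    (V : Fin n → ℝ) (β : ℝ) (d : Fin n → ℝ) {γ : ℝ → Fin n → ℝ} {γ' : Fin n → ℝ} {s : Set ℝ}
    {t : ℝ} (h : HasDerivWithinAt γ γ' s t) (hpos : ∀ i, 0 < γ t i) :
    HasDerivWithinAt (fun u => gradF W V β (γ u) ⬝ᵥ d) (d ⬝ᵥ (hessF W β (γ t)).mulVec γ') s t := by
  have hc := hasDerivWithinAt_apply h
  have h1 : HasDerivWithinAt (fun u => gradF W V β (γ u) ⬝ᵥ d)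
      (∑ i, (W.mulVec γ' i + β * (γ' i / γ t i)) * d i) s t := by
    exact HasDerivWithinAt.fun_sum fun i _ => ((((hasDerivWithinAt_mulVec W h i).const_add
      (V i)).fun_add (((hc i).log (hpos i).ne').const_mul β)).add_const β).mul_const (d i)
  refine h1.congr_deriv ?_
  simp only [hessF, Matrix.add_mulVec, Matrix.smul_mulVec, dotProduct, Pi.add_apply,
    Pi.smul_apply, Matrix.mulVec_diagonal, smul_eq_mul]
  exact Finset.sum_congr rfl fun i _ => by ring

/-- Strong convexity of the free energy along the segment joining two interior points. -/
theorem freeEnergy_strongly_convex {W : Matrix (Fin n) (Fin n) ℝ} (hW : W.IsSymm)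
    (V : Fin n → ℝ) (β : ℝ) {lam : ℝ}
    (hHess : ∀ σ : Fin n → ℝ, PoG σ → ∀ Φ : Fin n → ℝ,
      lam * (∑ i, (Φ i)^2) ≤ Φ ⬝ᵥ (hessF W β σ).mulVec Φ)
    {x y : Fin n → ℝ} (hx : PoG x) (hy : PoG y) :
    freeEnergy W V β x + gradF W V β x ⬝ᵥ (y - x) + lam / 2 * ∑ i, ((y - x) i) ^ 2
      ≤ freeEnergy W V β y := by
  set d := y - x with hd
  set N := ∑ i, (d i) ^ 2 with hN
  set γ : ℝ → Fin n → ℝ := fun s => x + s • d with hγ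
  have hγ' : ∀ (S : Set ℝ) s, HasDerivWithinAt γ d S s := fun S s =>
    hasDerivWithinAt_pi.2 fun i =>
      (((hasDerivWithinAt_id s S).mul_const (d i)).const_add (x i)).congr_deriv (one_mul _)
  have hPo : ∀ s ∈ Set.Icc (0 : ℝ) 1, PoG (γ s) := by
    rintro s ⟨hs0, hs1⟩
    have happ : ∀ i, γ s i = (1 - s) * x i + s * y i := fun i => by
      simp only [hγ, hd, Pi.add_apply, Pi.smul_apply, Pi.sub_apply, smul_eq_mul]; ring
    refine ⟨?_, fun i => ?_⟩
    · simp only [happ, Finset.sum_add_distrib, ← Finset.mul_sum, hx.1, hy.1]; ring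
    · rw [happ]
      rcases hs0.eq_or_lt with rfl | hs
      · simpa using hx.2 i
      · exact add_pos_of_nonneg_of_pos (mul_nonneg (by linarith) (hx.2 i).le)
          (mul_pos hs (hy.2 i))
  have hγ0 : γ 0 = x := by simp [hγ]
  have hγ1 : γ 1 = y := by simp [hγ, hd]
  have hmono : ∀ (f f' : ℝ → ℝ),
      (∀ s ∈ Set.Icc (0 : ℝ) 1, HasDerivWithinAt f (f' s) (Set.Icc 0 1) s) →
      (∀ s ∈ Set.Icc (0 : ℝ) 1, 0 ≤ f' s) → MonotoneOn f (Set.Icc 0 1) := by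
    intro f f' hf hf'
    refine monotoneOn_of_hasDerivWithinAt_nonneg (convex_Icc 0 1)
      (fun s hs => (hf s hs).continuousWithinAt) (f' := f')
      (fun s hs => (hf s (interior_subset hs)).mono interior_subset)
      (fun s hs => hf' s (interior_subset hs))
  have h0 : (0 : ℝ) ∈ Set.Icc (0 : ℝ) 1 := by simp
  have h1 : (1 : ℝ) ∈ Set.Icc (0 : ℝ) 1 := by simp
  have hgrad : MonotoneOn (fun s => gradF W V β (γ s) ⬝ᵥ d - s * (lam * N)) (Set.Icc 0 1) := by
    refine hmono _ (fun s => d ⬝ᵥ (hessF W β (γ s)).mulVec d - 1 * (lam * N)) (fun s hs => ?_)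
      (fun s hs => ?_)
    · exact (hasDerivWithinAt_gradF_dotProduct W V β d (hγ' _ s) (hPo s hs).2).fun_sub
        ((hasDerivWithinAt_id s _).mul_const _)
    · linarith [hHess _ (hPo s hs) d]
  have hF : MonotoneOn (fun s => freeEnergy W V β (γ s) -
      (s * (gradF W V β x ⬝ᵥ d) + s ^ 2 * (lam * N / 2))) (Set.Icc 0 1) := by
    refine hmono _ (fun s => gradF W V β (γ s) ⬝ᵥ d -
      (1 * (gradF W V β x ⬝ᵥ d) + (2 * s) * (lam * N / 2))) (fun s hs => ?_) (fun s hs => ?_)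
    · have hsq : HasDerivWithinAt (fun s : ℝ => s ^ 2) (2 * s) (Set.Icc 0 1) s := by
        simpa using (hasDerivWithinAt_id s (Set.Icc 0 1)).fun_pow 2
      exact (hasDerivWithinAt_freeEnergy hW V β (hγ' _ s) (hPo s hs).2).fun_sub
        (((hasDerivWithinAt_id s _).mul_const _).fun_add (hsq.mul_const _))
    · have := hgrad h0 hs hs.1
      simp only [hγ0] at this
      linarith
  have := hF h0 h1 zero_le_one
  simp only [hγ0, hγ1] at this
  linarith

/-- Polyak–Łojasiewicz inequality for the free energy on the simplex. -/
theorem freeEnergy_sub_le {W : Matrix (Fin n) (Fin n) ℝ} (hW : W.IsSymm)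
    (V : Fin n → ℝ) (β : ℝ) {lam : ℝ} (hlam : 0 < lam)
    (hHess : ∀ σ : Fin n → ℝ, PoG σ → ∀ Φ : Fin n → ℝ,
      lam * (∑ i, (Φ i)^2) ≤ Φ ⬝ᵥ (hessF W β σ).mulVec Φ)
    {x y : Fin n → ℝ} (hx : PoG x) (hy : PoG y) (c : ℝ) :
    2 * lam * (freeEnergy W V β x - freeEnergy W V β y) ≤ ∑ i, (gradF W V β x i - c) ^ 2 := by
  have h := freeEnergy_strongly_convex hW V β hHess hx hy
  have hd : ∑ i, (y - x) i = 0 := by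
    simp only [Pi.sub_apply, Finset.sum_sub_distrib, hx.1, hy.1, sub_self]
  have hsq : 0 ≤ ∑ i, ((gradF W V β x i - c) + lam * (y - x) i) ^ 2 :=
    Finset.sum_nonneg fun i _ => sq_nonneg _
  have hexp : ∑ i, ((gradF W V β x i - c) + lam * (y - x) i) ^ 2
      = ∑ i, (gradF W V β x i - c) ^ 2 + 2 * lam * (gradF W V β x ⬝ᵥ (y - x))
        - 2 * lam * c * ∑ i, (y - x) i + lam ^ 2 * ∑ i, ((y - x) i) ^ 2 := by
    simp only [dotProduct, Finset.mul_sum, ← Finset.sum_add_distrib, ← Finset.sum_sub_distrib]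
    exact Finset.sum_congr rfl fun i _ => by ring
  rw [hexp, hd] at hsq
  nlinarith [mul_le_mul_of_nonneg_left h (by positivity : 0 ≤ 2 * lam)]

theorem abs_add_mulVec_le (W : Matrix (Fin n) (Fin n) ℝ) (V : Fin n → ℝ) {ρ : Fin n → ℝ}
    (hρ : PoG ρ) (i : Fin n) :
    |V i + W.mulVec ρ i| ≤ ⨆ i : Fin n, ⨆ j : Fin n, (|V i| + |W i j|) := by
  set S := ⨆ i : Fin n, ⨆ j : Fin n, (|V i| + |W i j|)
  have hS : ∀ k, |V i| + |W i k| ≤ S := fun k =>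
    (le_ciSup (f := fun j => |V i| + |W i j|) (Set.finite_range _).bddAbove k).trans
      (le_ciSup (f := fun i => ⨆ j : Fin n, (|V i| + |W i j|)) (Set.finite_range _).bddAbove i)
  have h : V i + W.mulVec ρ i = ∑ k, (V i + W i k) * ρ k := by
    simp only [add_mul, Finset.sum_add_distrib, ← Finset.mul_sum, hρ.1, mul_one]
    rfl
  calc |V i + W.mulVec ρ i| ≤ ∑ k, |(V i + W i k) * ρ k| := by
        rw [h]; exact Finset.abs_sum_le_sum_abs _ _
    _ ≤ ∑ k, S * ρ k := by
        refine Finset.sum_le_sum fun k _ => ?_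
        rw [abs_mul, abs_of_pos (hρ.2 k)]
        exact mul_le_mul_of_nonneg_right ((abs_add_le _ _).trans (hS k)) (hρ.2 k).le
    _ = S := by rw [← Finset.mul_sum, hρ.1, mul_one]

/-- The entropic part of the gradient dominates when two densities are far apart. -/
theorem gradF_lt_gradF (W : Matrix (Fin n) (Fin n) ℝ) (V : Fin n → ℝ) {β : ℝ} (hβ : 0 < β)
    {ρ : Fin n → ℝ} (hρ : PoG ρ) {i j : Fin n}
    (h : (2 * Mconst W V) ^ (1 / β) * ρ j ≤ ρ i) :
    gradF W V β ρ j < gradF W V β ρ i := by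
  have hM : 0 < 2 * Mconst W V := mul_pos two_pos (Real.exp_pos _)
  have hc : 0 < (2 * Mconst W V) ^ (1 / β) := Real.rpow_pos_of_pos hM _
  have hlog := Real.log_le_log (mul_pos hc (hρ.2 j)) h
  rw [Real.log_mul hc.ne' (hρ.2 j).ne', Real.log_rpow hM, Mconst,
    Real.log_mul two_ne_zero (Real.exp_pos _).ne', Real.log_exp] at hlog
  have hlog' := mul_le_mul_of_nonneg_left hlog hβ.le
  rw [mul_add, ← mul_assoc, mul_one_div_cancel hβ.ne', one_mul] at hlog'
  have hi := abs_le.1 (abs_add_mulVec_le W V hρ i)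
  have hj := abs_le.1 (abs_add_mulVec_le W V hρ j)
  have hlog2 := Real.log_pos one_lt_two
  unfold gradF
  linarith [hi.1, hj.2]

/-- The region cut out by the bounds `e #Bᶜ ≤ ∑ j ∈ B, σ j` is invariant under the flow as soon as
the levels `e` decrease quickly enough. -/
theorem IsSolution.level_le_sum {ω : Fin n → Fin n → ℝ} (hG : IsGraph ω)
    {W : Matrix (Fin n) (Fin n) ℝ} {V : Fin n → ℝ} {β : ℝ} (hβ : 0 < β) {ρ : ℝ → Fin n → ℝ}
    (hsol : IsSolution ω W V β ρ) {e : ℕ → ℝ} (he0 : e 0 = 1)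
    (he : ∀ l, (1 + (2 * Mconst W V) ^ (1 / β)) * e (l + 1) ≤ e l)
    (hinit : ∀ B : Finset (Fin n), B.Nonempty → e #Bᶜ ≤ ∑ j ∈ B, ρ 0 j)
    {t : ℝ} (ht : 0 ≤ t) {B : Finset (Fin n)} (hB : B.Nonempty) :
    e #Bᶜ ≤ ∑ j ∈ B, ρ t j := by
  obtain ⟨hPo, hder⟩ := hsol
  obtain ⟨hs, hdiag, hnn, hconn⟩ := hG
  set S : Set ℝ := {u | ∀ B : Finset (Fin n), B.Nonempty → e #Bᶜ ≤ ∑ j ∈ B, ρ u j} with hS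
  have hderB : ∀ (B : Finset (Fin n)), ∀ u ∈ Set.Ici (0 : ℝ),
      HasDerivWithinAt (fun u => ∑ j ∈ B, ρ u j)
        (∑ j ∈ B, (-(Lmat ω (ρ u)).mulVec (gradF W V β (ρ u))) j) (Set.Ici 0) u := fun B u hu =>
    HasDerivWithinAt.fun_sum fun j _ => hasDerivWithinAt_apply (hder u hu) j
  have hcl : IsClosed (S ∩ Set.Icc 0 t) := by
    have hT : IsClosed {σ : Fin n → ℝ |
        ∀ B : Finset (Fin n), B.Nonempty → e #Bᶜ ≤ ∑ j ∈ B, σ j} := by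
      simp only [Set.ofPred_forall]
      exact isClosed_iInter fun B => isClosed_iInter fun _ =>
        isClosed_le continuous_const (by fun_prop)
    have hcont : ContinuousOn ρ (Set.Icc 0 t) := fun u hu =>
      (hder u hu.1).continuousWithinAt.mono Set.Icc_subset_Ici_self
    rw [Set.inter_comm]
    exact hcont.preimage_isClosed_of_isClosed isClosed_Icc hT
  refine hcl.Icc_subset_of_forall_mem_nhdsWithin (a := 0) (b := t) hinit ?_
    (Set.right_mem_Icc.2 ht) B hB
  rintro u ⟨huS, hu0, hut⟩
  have hsub : Set.Ioi u ⊆ Set.Ici 0 := fun v hv => hu0.trans (le_of_lt hv)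
  refine (Filter.eventually_all (l := nhdsWithin u (Set.Ioi u))).2 fun B => ?_
  refine Filter.eventually_imp_distrib_left.2 fun hB => ?_
  have hd := (hderB B u hu0).mono hsub
  rcases (huS B hB).lt_or_eq with hlt | heq
  · exact (hd.continuousWithinAt.eventually (lt_mem_nhds hlt)).mono fun v hv => hv.le
  by_cases hBc : Bᶜ = ∅
  · refine eventually_mem_nhdsWithin.mono fun v hv => ?_
    rw [hBc, Finset.card_empty, he0, (Finset.compl_eq_empty_iff B).1 hBc, (hPo v (hsub hv)).1]
  have hF : ∀ j ∈ B, ∀ i ∉ B, gradF W V β (ρ u) j < gradF W V β (ρ u) i := by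
    intro j hj i hi
    refine gradF_lt_gradF W V hβ (hPo u hu0) ?_
    have hins := huS (insert i B) (Finset.insert_nonempty i B)
    have hcard : #Bᶜ = #(insert i B)ᶜ + 1 := by
      rw [Finset.compl_insert, Finset.card_erase_add_one (Finset.mem_compl.2 hi)]
    have hlev := he #(insert i B)ᶜ
    rw [← hcard, heq] at hlev
    rw [Finset.sum_insert hi] at hins
    have hj' : ρ u j ≤ ∑ j ∈ B, ρ u j :=
      Finset.single_le_sum (f := ρ u) (fun k _ => ((hPo u hu0).2 k).le) hj
    have hc : 0 ≤ (2 * Mconst W V) ^ (1 / β) :=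
      Real.rpow_nonneg (mul_pos two_pos (Real.exp_pos _)).le _
    nlinarith [mul_le_mul_of_nonneg_left hj' hc]
  have hθ : ∀ i j, 0 < theta (ρ u) i j := fun i j =>
    half_pos (add_pos ((hPo u hu0).2 i) ((hPo u hu0).2 j))
  have hpos : 0 < ∑ j ∈ B, (-(Lmat ω (ρ u)).mulVec (gradF W V β (ρ u))) j := by
    rw [Lmat_eq_Lhat, sum_neg_Lhat_mulVec (fun i => by rw [hdiag, zero_mul])
      (fun i j => by rw [hs, theta_comm])]
    have hterm : ∀ j ∈ B, ∀ i ∈ Bᶜ, 0 ≤ ω j i * theta (ρ u) j i *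
        (gradF W V β (ρ u) i - gradF W V β (ρ u) j) := fun j hj i hi =>
      mul_nonneg (mul_nonneg (hnn j i) (hθ j i).le)
        (sub_nonneg.2 (hF j hj i (Finset.mem_compl.1 hi)).le)
    obtain ⟨a, ha⟩ := hB
    obtain ⟨b, hb⟩ := Finset.nonempty_iff_ne_empty.2 hBc
    obtain ⟨j, hj, i, hi, hji⟩ := hconn.exists_crossing_edge ha (Finset.mem_compl.1 hb)
    refine Finset.sum_pos' (fun j hj => Finset.sum_nonneg (hterm j hj)) ⟨j, hj, ?_⟩
    refine Finset.sum_pos' (hterm j hj) ⟨i, Finset.mem_compl.2 hi, ?_⟩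
    exact mul_pos (mul_pos ((hnn j i).lt_of_ne' hji) (hθ j i)) (sub_pos.2 (hF j hj i hi))
  have hslope := (hasDerivWithinAt_iff_tendsto_slope' (lt_irrefl u)).1 hd
  filter_upwards [hslope.eventually (lt_mem_nhds hpos), eventually_mem_nhdsWithin] with v hv huv
  rw [slope_def_field, lt_div_iff₀ (sub_pos.2 huv), zero_mul, sub_pos, ← heq] at hv
  exact hv.le

theorem mconst_pos (hn : 2 ≤ n) (W : Matrix (Fin n) (Fin n) ℝ) (V : Fin n → ℝ) (β : ℝ)
    {ρ0 : Fin n → ℝ} (hρ0 : PoG ρ0) : 0 < mconst W V β ρ0 := by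
  have : Nonempty (Fin n) := ⟨⟨0, by omega⟩⟩
  obtain ⟨i, hi⟩ := exists_eq_ciInf_of_finite (f := ρ0)
  have hc : 0 ≤ (2 * Mconst W V) ^ (1 / β) :=
    Real.rpow_nonneg (mul_pos two_pos (Real.exp_pos _)).le _
  have hq : 0 < 1 / (1 + (2 * Mconst W V) ^ (1 / β)) := by positivity
  have hδ : 0 < ⨅ i, ρ0 i := hi ▸ hρ0.2 i
  exact mul_pos (mul_pos one_half_pos (pow_pos hq _)) (lt_min hq hδ)

/-- Solutions of the Fokker–Planck equation stay uniformly away from the boundary. -/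
theorem IsSolution.mconst_le (hn : 2 ≤ n) {ω : Fin n → Fin n → ℝ} (hG : IsGraph ω)
    {W : Matrix (Fin n) (Fin n) ℝ} {V : Fin n → ℝ} {β : ℝ} (hβ : 0 < β) {ρ : ℝ → Fin n → ℝ}
    (hsol : IsSolution ω W V β ρ) {t : ℝ} (ht : 0 ≤ t) (i : Fin n) :
    mconst W V β (ρ 0) ≤ ρ t i := by
  have h0 : PoG (ρ 0) := hsol.1 0 Set.self_mem_Ici
  have hc : 0 ≤ (2 * Mconst W V) ^ (1 / β) :=
    Real.rpow_nonneg (mul_pos two_pos (Real.exp_pos _)).le _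
  set c := (2 * Mconst W V) ^ (1 / β)
  set q := 1 / (1 + c) with hq
  set δ := ⨅ i, ρ 0 i
  have hcq : (1 + c) * q = 1 := mul_one_div_cancel (by positivity)
  have hq0 : 0 ≤ q := by positivity
  have hq1 : q ≤ 1 := by rw [hq, div_le_one (by positivity)]; linarith
  have hδ0 : 0 ≤ δ := Real.iInf_nonneg fun i => (h0.2 i).le
  have hmin0 : 0 ≤ min q δ := le_min hq0 hδ0
  let e : ℕ → ℝ := fun l => Nat.casesOn l 1 fun k => 1 / 2 * q ^ k * min q δ
  have hlev : ∀ l, (1 + c) * e (l + 1) ≤ e l := by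
    rintro (_ | k)
    · change (1 + c) * (1 / 2 * q ^ 0 * min q δ) ≤ 1
      have := mul_le_mul_of_nonneg_left (min_le_left q δ) (by positivity : 0 ≤ 1 + c)
      rw [pow_zero]
      linarith
    · change (1 + c) * (1 / 2 * q ^ (k + 1) * min q δ) ≤ 1 / 2 * q ^ k * min q δ
      rw [pow_succ]
      refine le_of_eq ?_
      linear_combination (1 / 2 * q ^ k * min q δ) * hcq
  have hinit : ∀ B : Finset (Fin n), B.Nonempty → e #Bᶜ ≤ ∑ j ∈ B, ρ 0 j := by
    intro B hB
    rcases hk : #Bᶜ with _ | k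
    · rw [Finset.card_eq_zero, Finset.compl_eq_empty_iff] at hk
      rw [hk, h0.1]
      exact le_rfl
    · obtain ⟨a, ha⟩ := hB
      calc 1 / 2 * q ^ k * min q δ ≤ 1 * min q δ := by
            have := pow_le_one₀ hq0 hq1 (n := k)
            gcongr
            linarith
        _ ≤ δ := by rw [one_mul]; exact min_le_right _ _
        _ ≤ ρ 0 a := ciInf_le (Set.finite_range _).bddBelow a
        _ ≤ ∑ j ∈ B, ρ 0 j := Finset.single_le_sum (f := ρ 0) (fun k _ => (h0.2 k).le) ha
  have h := hsol.level_le_sum hG hβ (e := e) rfl hlev hinit ht (Finset.singleton_nonempty i)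
  have hcard : #({i} : Finset (Fin n))ᶜ = n - 2 + 1 := by
    rw [Finset.card_compl, Fintype.card_fin, Finset.card_singleton]; omega
  rwa [hcard, Finset.sum_singleton] at h

/-- Lower bound for the energy dissipation rate by the deviation of the potential `Φ` from its
mean. -/
theorem dotProduct_Lmat_mulVec_ge {ω : Fin n → Fin n → ℝ} (hG : IsGraph ω) (hn : 0 < n)
    {σ : Fin n → ℝ} {m : ℝ} (hm0 : 0 ≤ m) (hm : ∀ i, m ≤ σ i) (Φ : Fin n → ℝ) :
    m * (lamSec (Lhat ω) * ∑ i, (Φ i - (∑ k, Φ k) / n) ^ 2) ≤ Φ ⬝ᵥ (Lmat ω σ).mulVec Φ := by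
  obtain ⟨hs, hdiag, hnn, -⟩ := hG
  set Ψ : Fin n → ℝ := fun i => Φ i - (∑ k, Φ k) / n with hΨ
  have hΨ0 : ∑ i, Ψ i = 0 := by
    have : (n : ℝ) ≠ 0 := by exact_mod_cast hn.ne'
    simp only [hΨ, Finset.sum_sub_distrib, Finset.sum_const, Finset.card_univ, Fintype.card_fin,
      nsmul_eq_mul]
    field_simp
    ring
  have h := lamSec_mul_le hdiag hs hnn hΨ0
  rw [dotProduct_Lhat_mulVec hdiag hs] at h
  rw [Lmat_eq_Lhat, dotProduct_Lhat_mulVec (fun i => by rw [hdiag, zero_mul])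
      (fun i j => by rw [hs, theta_comm])]
  refine (mul_le_mul_of_nonneg_left h hm0).trans ?_
  rw [mul_left_comm, Finset.mul_sum]
  simp only [Finset.mul_sum]
  refine Finset.sum_le_sum fun i _ => Finset.sum_le_sum fun j _ => ?_
  have hθ : m ≤ theta σ i j := by unfold theta; linarith [hm i, hm j]
  have hsq : (Ψ i - Ψ j) ^ 2 = (Φ i - Φ j) ^ 2 := by simp only [hΨ]; ring
  rw [hsq]
  nlinarith [mul_le_mul_of_nonneg_right hθ (mul_nonneg (hnn i j) (sq_nonneg (Φ i - Φ j)))]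

/-- A differential inequality `f' ≤ -C f` on `[0, ∞)` yields exponential decay. -/
theorem le_exp_mul_of_hasDerivWithinAt_le {f f' : ℝ → ℝ} {C : ℝ}
    (hf : ∀ t ∈ Set.Ici (0 : ℝ), HasDerivWithinAt f (f' t) (Set.Ici 0) t)
    (hle : ∀ t ∈ Set.Ici (0 : ℝ), f' t ≤ -C * f t) {t : ℝ} (ht : 0 ≤ t) :
    f t ≤ Real.exp (-C * t) * f 0 := by
  have hd : ∀ t ∈ Set.Ici (0 : ℝ), HasDerivWithinAt (fun t => Real.exp (t * C) * f t)
      (Real.exp (t * C) * (1 * C) * f t + Real.exp (t * C) * f' t) (Set.Ici 0) t := fun t ht =>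
    (((hasDerivWithinAt_id t _).mul_const C).exp).fun_mul (hf t ht)
  have hanti : AntitoneOn (fun t => Real.exp (t * C) * f t) (Set.Ici 0) := by
    refine antitoneOn_of_hasDerivWithinAt_nonpos (convex_Ici 0)
      (fun t ht => (hd t ht).continuousWithinAt)
      (fun t ht => (hd t (interior_subset ht)).mono interior_subset) fun t ht => ?_
    have := mul_le_mul_of_nonneg_left (hle t (interior_subset ht)) (Real.exp_pos (t * C)).le
    linarith
  have h := hanti Set.self_mem_Ici ht ht
  simp only [zero_mul, Real.exp_zero, one_mul] at h
  have h' := mul_le_mul_of_nonneg_left h (Real.exp_pos (-C * t)).le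
  rwa [← mul_assoc, ← Real.exp_add, show -C * t + t * C = 0 by ring, Real.exp_zero,
    one_mul] at h'

/-- main theorem: entropy dissipation on graphs: with
`r = √2 Deg(G) (max_{(i,j)∈E} ω_{ij}) (h₁/λ^{3/2}) ((1-m(ρ⁰))/m(ρ⁰)²)
      (λ_max(L̂)/λ_sec(L̂)²) √(𝓕(ρ⁰)-𝓕(ρ∞))` and
`C = 2 m(ρ⁰) λ_sec(L̂) λ / (r+1)²`, the solution of the Fokker–Planck equation satisfies
`𝓕(ρ(t)) - 𝓕(ρ∞) ≤ e^{-Ct} (𝓕(ρ⁰) - 𝓕(ρ∞))` for all `t ≥ 0`. -/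
theorem entropy_dissipation
    (n : ℕ) (hn : 2 ≤ n) (ω : Fin n → Fin n → ℝ) (hG : IsGraph ω)
    (W : Matrix (Fin n) (Fin n) ℝ) (hW : W.IsSymm) (V : Fin n → ℝ) (β : ℝ) (hβ : 0 < β)
    (ρ0 : Fin n → ℝ) (hρ0 : PoG ρ0)
    (ρinf : Fin n → ℝ) (hGibbs : IsGibbs W V β ρinf)
    (ρ : ℝ → Fin n → ℝ) (hsol : IsSolution ω W V β ρ) (hinit : ρ 0 = ρ0)
    (lam : ℝ) (hlam : 0 < lam)
    (hHess : ∀ σ : Fin n → ℝ, PoG σ → ∀ Φ : Fin n → ℝ,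
      lam * (∑ i, (Φ i)^2) ≤ Φ ⬝ᵥ (hessF W β σ).mulVec Φ)
    (h1 : ℝ) (hh1 : 0 < h1)
    (hnorm : ∀ σ : Fin n → ℝ, PG σ →
      (∀ i, min (mconst W V β ρ0) (⨅ j, ρinf j) ≤ σ i) →
      matNorm1 (hessF W β σ) ≤ h1)
    (r C : ℝ)
    (hr : r = Real.sqrt 2 * (maxDeg ω : ℝ) * maxWeight ω *
      (h1 / lam ^ ((3:ℝ)/2)) * ((1 - mconst W V β ρ0) / (mconst W V β ρ0)^2) *
      (lamMax (Lhat ω) / (lamSec (Lhat ω))^2) *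
      Real.sqrt (freeEnergy W V β ρ0 - freeEnergy W V β ρinf))
    (hC : C = 2 * mconst W V β ρ0 * lamSec (Lhat ω) * lam * (1 / (r + 1)^2)) :
    ∀ t ∈ Set.Ici (0:ℝ),
      freeEnergy W V β (ρ t) - freeEnergy W V β ρinf ≤
        Real.exp (-C * t) * (freeEnergy W V β ρ0 - freeEnergy W V β ρinf) := by
  have hn0 : 0 < n := by omega
  have hm := mconst_pos hn W V β hρ0
  obtain ⟨hs, hdiag, hnn, -⟩ := id hG
  have hlower : ∀ t ∈ Set.Ici (0 : ℝ), ∀ i, mconst W V β ρ0 ≤ ρ t i := fun t ht i =>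
    hinit ▸ hsol.mconst_le hn hG hβ ht i
  have hm1 : mconst W V β ρ0 ≤ 1 := by
    let i : Fin n := ⟨0, hn0⟩
    calc mconst W V β ρ0 ≤ ρ0 i := hinit ▸ hlower 0 Set.self_mem_Ici i
      _ ≤ ∑ j, ρ0 j := Finset.single_le_sum (f := ρ0) (fun k _ => (hρ0.2 k).le) (Finset.mem_univ i)
      _ = 1 := hρ0.1
  have hr0 : 0 ≤ r := by
    have hw : 0 ≤ maxWeight ω := Real.iSup_nonneg fun i => Real.iSup_nonneg fun j => hnn i j
    have hM := lamMax_nonneg hdiag hs hnn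
    have h1m := sub_nonneg.2 hm1
    rw [hr]
    positivity
  have hsec := lamSec_nonneg hdiag hs hnn
  have hCle : C ≤ 2 * mconst W V β ρ0 * lamSec (Lhat ω) * lam := by
    rw [hC]
    refine mul_le_of_le_one_right (by positivity) ?_
    rw [div_le_one (by positivity)]
    nlinarith
  have hC0 : 0 ≤ C := by rw [hC]; positivity
  intro t ht
  rw [← hinit]
  refine le_exp_mul_of_hasDerivWithinAt_le
    (f := fun t => freeEnergy W V β (ρ t) - freeEnergy W V β ρinf)
    (fun t ht => (hasDerivWithinAt_freeEnergy hW V β (hsol.2 t ht) (hsol.1 t ht).2).sub_const _)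
    (fun t ht => ?_) ht
  have hdiss := dotProduct_Lmat_mulVec_ge hG hn0 hm.le (hlower t ht) (gradF W V β (ρ t))
  have hPL := freeEnergy_sub_le hW V β hlam hHess (hsol.1 t ht) hGibbs.1
    ((∑ k, gradF W V β (ρ t) k) / n)
  set N := ∑ i, (gradF W V β (ρ t) i - (∑ k, gradF W V β (ρ t) k) / n) ^ 2
  have hN : 0 ≤ N := Finset.sum_nonneg fun i _ => sq_nonneg _
  rw [dotProduct_neg]
  have hCN := mul_le_mul_of_nonneg_right hCle hN
  have hCPL := mul_le_mul_of_nonneg_left hPL hC0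
  have key : 2 * lam * (C * (freeEnergy W V β (ρ t) - freeEnergy W V β ρinf)) ≤
      2 * lam * (gradF W V β (ρ t) ⬝ᵥ (Lmat ω (ρ t)).mulVec (gradF W V β (ρ t))) := by
    linarith [mul_le_mul_of_nonneg_left hdiss (by positivity : 0 ≤ 2 * lam)]
  have := le_of_mul_le_mul_left key (by positivity)
  linarith

end FPEGraph
end
end

section
/- For every initial condition ρ⁰ ∈ P_o(G) there exists a unique continuously differentiable solution ρ : [0,∞) → P_o(G) of the Fokker–Planck equation ρ'(t) = −L(ρ(t))F(ρ(t)) with ρ(0) = ρ⁰. -/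
open Finset Filter Matrix
open scoped Classical

noncomputable section

namespace FPEGraph

variable {n : ℕ}

/-- The right-hand side `-L(ρ)F(ρ)` of the Fokker–Planck equation. -/
def field (ω : Fin n → Fin n → ℝ) (W : Matrix (Fin n) (Fin n) ℝ) (V : Fin n → ℝ) (β : ℝ)
    (x : Fin n → ℝ) : Fin n → ℝ :=
  -(Lmat ω x).mulVec (gradF W V β x)

section Field

variable {ω : Fin n → Fin n → ℝ} {W : Matrix (Fin n) (Fin n) ℝ} {V : Fin n → ℝ} {β : ℝ}

lemma field_apply (hω : ∀ i, ω i i = 0) (x : Fin n → ℝ) (i : Fin n) :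
    field ω W V β x i =
      ∑ j, ω i j * theta x i j * (gradF W V β x j - gradF W V β x i) := by
  have h : ∀ j, Lmat ω x i j * gradF W V β x j =
      (if i = j then (∑ k, ω i k * theta x i k) * gradF W V β x i else 0)
        - ω i j * theta x i j * gradF W V β x j := by
    intro j
    by_cases hij : i = j
    · subst hij; simp [Lmat, hω]
    · simp [Lmat, hij]
  simp only [field, Pi.neg_apply, Matrix.mulVec, dotProduct, h, Finset.sum_sub_distrib,
    Finset.sum_ite_eq, Finset.mem_univ, if_true, mul_sub, Finset.sum_mul]
  ring

lemma sum_field (hG : IsGraph ω) (x : Fin n → ℝ) : ∑ i, field ω W V β x i = 0 := by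
  have h : ∑ i, field ω W V β x i = -∑ i, field ω W V β x i := by
    conv_lhs => simp only [field_apply hG.2.1]
    rw [Finset.sum_comm, ← Finset.sum_neg_distrib]
    refine Finset.sum_congr rfl fun i _ => ?_
    rw [field_apply hG.2.1, ← Finset.sum_neg_distrib]
    refine Finset.sum_congr rfl fun j _ => ?_
    rw [hG.1 i j, theta, theta]
    ring
  linarith

lemma PoG.le_one {x : Fin n → ℝ} (hx : PoG x) (i : Fin n) : x i ≤ 1 :=
  hx.1 ▸ Finset.single_le_sum (f := x) (fun j _ => (hx.2 j).le) (Finset.mem_univ i)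

/-- The non-entropic part of the gradient is bounded on the simplex. -/
lemma exists_potential_diff_le (W : Matrix (Fin n) (Fin n) ℝ) (V : Fin n → ℝ) :
    ∃ C : ℝ, 0 ≤ C ∧ ∀ x : Fin n → ℝ, PoG x → ∀ i j,
      -C ≤ (V j + W.mulVec x j) - (V i + W.mulVec x i) := by
  set B : ℝ := ∑ i, (|V i| + ∑ k, |W i k|)
  have hB0 : 0 ≤ B := by positivity
  refine ⟨2 * B, by positivity, fun x hx i j => ?_⟩
  have key : ∀ i, |V i + W.mulVec x i| ≤ B := by
    intro i
    calc |V i + W.mulVec x i| ≤ |V i| + |W.mulVec x i| := abs_add_le _ _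
      _ ≤ |V i| + ∑ k, |W i k| := by
        gcongr
        rw [Matrix.mulVec, dotProduct]
        refine (Finset.abs_sum_le_sum_abs _ _).trans (Finset.sum_le_sum fun k _ => ?_)
        rw [abs_mul, abs_of_pos (hx.2 k)]
        exact mul_le_of_le_one_right (abs_nonneg _) (hx.le_one k)
      _ ≤ B := Finset.single_le_sum (f := fun i => |V i| + ∑ k, |W i k|)
        (fun _ _ => by positivity) (Finset.mem_univ i)
  have h1 := abs_le.1 (key i)
  have h2 := abs_le.1 (key j)
  linarith [h1.2, h2.1]

lemma edge_flux_lower {C a b : ℝ} (hβ : 0 < β) (hC : 0 ≤ C) (ha : 0 < a) (hab : a ≤ b) :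
    -((1 + Real.exp (C / β)) / 2 * C) * a ≤
      (a + b) / 2 * (-C + β * (Real.log b - Real.log a)) := by
  have hlog : 0 ≤ Real.log b - Real.log a := sub_nonneg.2 (Real.log_le_log ha hab)
  by_cases h : C ≤ β * (Real.log b - Real.log a)
  · have h1 : 0 ≤ (a + b) / 2 * (-C + β * (Real.log b - Real.log a)) :=
      mul_nonneg (by linarith) (by linarith)
    have h2 : 0 ≤ (1 + Real.exp (C / β)) / 2 * C * a := by positivity
    linarith
  · push Not at h
    have hb : b ≤ Real.exp (C / β) * a := by
      rw [← Real.log_le_log_iff (by linarith) (by positivity),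
        Real.log_mul (Real.exp_pos _).ne' ha.ne', Real.log_exp]
      have : Real.log b - Real.log a ≤ C / β := by
        rw [le_div_iff₀ hβ]; linarith
      linarith
    have h1 : 0 ≤ (a + b) / 2 * (β * (Real.log b - Real.log a)) :=
      mul_nonneg (by linarith) (by positivity)
    nlinarith [mul_le_mul_of_nonneg_right hb hC]

/-- At a vertex of minimal density the density decays at most exponentially. -/
lemma exists_field_lower (hG : IsGraph ω) (hβ : 0 < β) (W : Matrix (Fin n) (Fin n) ℝ)
    (V : Fin n → ℝ) :
    ∃ K : ℝ, ∀ x : Fin n → ℝ, PoG x → ∀ i, (∀ j, x i ≤ x j) →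
      -K * x i < field ω W V β x i := by
  obtain ⟨C, hC, h⟩ := exists_potential_diff_le W V
  set D := (1 + Real.exp (C / β)) / 2 * C
  have hD0 : 0 ≤ D := by positivity
  refine ⟨(∑ i, ∑ j, ω i j) * D + 1, fun x hx i hi => ?_⟩
  have hxi := hx.2 i
  have h1 : -(∑ j, ω i j) * D * x i ≤ field ω W V β x i := by
    rw [field_apply hG.2.1, neg_mul, neg_mul, Finset.sum_mul, Finset.sum_mul,
      ← Finset.sum_neg_distrib]
    refine Finset.sum_le_sum fun j _ => ?_
    have e1 := edge_flux_lower hβ hC hxi (hi j)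
    have e2 : (x i + x j) / 2 * (-C + β * (Real.log (x j) - Real.log (x i))) ≤
        theta x i j * (gradF W V β x j - gradF W V β x i) := by
      refine mul_le_mul_of_nonneg_left ?_ (by linarith [hx.2 j])
      have := h x hx i j
      simp only [gradF]
      linarith
    calc -(ω i j * D * x i) = ω i j * (-D * x i) := by ring
      _ ≤ ω i j * (theta x i j * (gradF W V β x j - gradF W V β x i)) :=
        mul_le_mul_of_nonneg_left (e1.trans e2) (hG.2.2.1 i j)
      _ = _ := by ring
  have h2 : ∑ j, ω i j ≤ ∑ i, ∑ j, ω i j :=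
    Finset.single_le_sum (f := fun i => ∑ j, ω i j)
      (fun i _ => Finset.sum_nonneg fun j _ => hG.2.2.1 i j) (Finset.mem_univ i)
  have h3 := mul_le_mul_of_nonneg_right h2 (mul_nonneg hD0 hxi.le)
  nlinarith

lemma contDiffAt_field {x : Fin n → ℝ} (hω : ∀ i, ω i i = 0) (hx : ∀ i, 0 < x i) :
    ContDiffAt ℝ 1 (field ω W V β) x := by
  have hg : ∀ i, ContDiffAt ℝ 1 (fun y : Fin n → ℝ => gradF W V β y i) x := by
    intro i
    simp only [gradF, Matrix.mulVec, dotProduct]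
    have := (contDiffAt_pi.1 (contDiffAt_id (𝕜 := ℝ) (n := 1) (x := x)) i).log (hx i).ne'
    fun_prop
  rw [contDiffAt_pi]
  intro i
  simp only [field_apply hω, theta]
  fun_prop

lemma exists_lipschitz_field (hω : ∀ i, ω i i = 0) {ε : ℝ} (hε : 0 < ε) :
    ∃ K, LipschitzOnWith K (field ω W V β) (Set.Icc (fun _ => ε) (fun _ => 1)) := by
  refine LocallyLipschitzOn.exists_lipschitzOnWith_of_compact isCompact_Icc ?_
  intro x hx
  obtain ⟨K, t, ht, h⟩ := (contDiffAt_field (W := W) (V := V) (β := β) hω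
    fun i => hε.trans_le (hx.1 i)).exists_lipschitzOnWith
  exact ⟨K, t, mem_nhdsWithin_of_mem_nhds ht, h⟩

end Field

/-- A family of curves starting above a barrier `b` stays above it if, whenever some curve
touches the barrier while all others are above it, its derivative exceeds that of `b`. -/
lemma barrier {T : ℝ} {x x' : ℝ → Fin n → ℝ} {b b' : ℝ → ℝ}
    (hx : ∀ t ∈ Set.Icc 0 T, HasDerivWithinAt x (x' t) (Set.Icc 0 T) t)
    (hb : ∀ t, HasDerivAt b (b' t) t) (h0 : ∀ i, b 0 < x 0 i)
    (hlt : ∀ t ∈ Set.Icc 0 T, ∀ i, (∀ j, b t ≤ x t j) → x t i = b t → b' t < x' t i) :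
    ∀ t ∈ Set.Icc 0 T, ∀ i, b t < x t i := by
  by_contra! hcon
  have hd : ∀ i, ∀ t ∈ Set.Icc 0 T,
      HasDerivWithinAt (fun s => x s i - b s) (x' t i - b' t) (Set.Icc 0 T) t := fun i t ht =>
    (hasDerivWithinAt_pi.1 (hx t ht) i).sub (hb t).hasDerivWithinAt
  have hc : ∀ i, ContinuousOn (fun s => x s i - b s) (Set.Icc 0 T) := fun i t ht =>
    (hd i t ht).continuousWithinAt
  set S : Set ℝ := ⋃ i, {t ∈ Set.Icc 0 T | x t i - b t ≤ 0}
  have hScl : IsClosed S := isClosed_iUnion_of_finite fun i =>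
    (hc i).preimage_isClosed_of_isClosed isClosed_Icc isClosed_Iic
  have hSne : S.Nonempty := by
    obtain ⟨t, ht, i, hi⟩ := hcon
    exact ⟨t, Set.mem_iUnion.2 ⟨i, ht, by linarith⟩⟩
  have hSbd : BddBelow S := ⟨0, fun t ht => by
    obtain ⟨i, hi⟩ := Set.mem_iUnion.1 ht
    exact hi.1.1⟩
  obtain ⟨i, ⟨hτ0, hτT⟩, hi⟩ := Set.mem_iUnion.1 (hScl.csInf_mem hSne hSbd)
  set τ := sInf S
  have hbefore : ∀ s ∈ Set.Ico 0 τ, ∀ j, 0 < x s j - b s := by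
    intro s hs j
    by_contra! hle
    exact (notMem_of_lt_csInf hs.2 hSbd)
      (Set.mem_iUnion.2 ⟨j, ⟨hs.1, hs.2.le.trans hτT⟩, hle⟩)
  have hτpos : 0 < τ := by
    refine lt_of_le_of_ne hτ0 fun h => ?_
    rw [← h] at hi
    linarith [h0 i]
  have hmem : Set.Ioo 0 τ ∈ nhdsWithin τ (Set.Iio τ) := Ioo_mem_nhdsLT hτpos
  have hsub : Set.Ioo 0 τ ⊆ Set.Icc 0 T := fun s hs => ⟨hs.1.le, hs.2.le.trans hτT⟩
  have hge : ∀ j, 0 ≤ x τ j - b τ := fun j => by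
    have h1 : Tendsto (fun s => x s j - b s) (nhdsWithin τ (Set.Ioo 0 τ))
        (nhds (x τ j - b τ)) := ((hc j) τ ⟨hτ0, hτT⟩).mono_left (nhdsWithin_mono _ hsub)
    rw [nhdsWithin_Ioo_eq_nhdsLT hτpos] at h1
    refine ge_of_tendsto h1 ?_
    filter_upwards [hmem] with s hs
    exact (hbefore s ⟨hs.1.le, hs.2⟩ j).le
  have heq : x τ i = b τ := by linarith [hge i]
  have hder := hlt τ ⟨hτ0, hτT⟩ i (fun j => by linarith [hge j]) heq
  have h2 := (hd i τ ⟨hτ0, hτT⟩).mono hsub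
  rw [hasDerivWithinAt_iff_tendsto_slope' (by simp), nhdsWithin_Ioo_eq_nhdsLT hτpos] at h2
  have h3 : x' τ i - b' τ ≤ 0 := by
    refine le_of_tendsto h2 ?_
    filter_upwards [hmem] with s hs
    rw [slope_def_field]
    have := hbefore s ⟨hs.1.le, hs.2⟩ i
    exact div_nonpos_of_nonneg_of_nonpos (by linarith) (by linarith [hs.2])
  linarith

/-- Componentwise truncation to the interval `[ε, 1]`. -/
def clamp (ε : ℝ) (x : Fin n → ℝ) : Fin n → ℝ := fun i => max ε (min 1 (x i))

lemma clamp_mem {ε : ℝ} (hε : ε ≤ 1) (x : Fin n → ℝ) :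
    clamp ε x ∈ Set.Icc (fun _ : Fin n => ε) (fun _ => 1) :=
  ⟨fun _ => le_max_left _ _, fun _ => max_le hε (min_le_left _ _)⟩

lemma clamp_eq_self {ε : ℝ} {x : Fin n → ℝ} (hx : x ∈ Set.Icc (fun _ : Fin n => ε) fun _ => 1) :
    clamp ε x = x := by
  ext i
  rw [clamp, min_eq_right (hx.2 i), max_eq_right (hx.1 i)]

lemma lipschitzWith_clamp (ε : ℝ) : LipschitzWith 1 (clamp ε : (Fin n → ℝ) → Fin n → ℝ) :=
  LipschitzWith.of_dist_le_mul fun x y => by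
    rw [NNReal.coe_one, one_mul, dist_pi_le_iff dist_nonneg]
    intro i
    have h := ((LipschitzWith.id.const_min 1).const_max ε).dist_le_mul (x i) (y i)
    rw [NNReal.coe_one, one_mul] at h
    exact h.trans (dist_le_pi_dist x y i)

/-- Solutions exist on compact intervals for a bounded and globally Lipschitz vector field. -/
lemma exists_solution_of_bounded {E : Type*} [NormedAddCommGroup E] [NormedSpace ℝ E]
    [CompleteSpace E] {f : E → E} {K L : NNReal} (hf : LipschitzWith K f)
    (hL : ∀ x, ‖f x‖ ≤ L) (x₀ : E) {T : ℝ} (hT : 0 ≤ T) :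
    ∃ y : ℝ → E, y 0 = x₀ ∧
      ∀ t ∈ Set.Icc 0 T, HasDerivWithinAt y (f (y t)) (Set.Icc 0 T) t := by
  have h : IsPicardLindelof (fun _ => f) (⟨0, Set.left_mem_Icc.2 hT⟩ : Set.Icc 0 T) x₀
      (L * T.toNNReal) 0 L K :=
    { lipschitzOnWith := fun _ _ => hf.lipschitzOnWith
      continuousOn := fun _ _ => continuousOn_const
      norm_le := fun _ _ x _ => hL x
      mul_max_le := by simp [hT] }
  exact h.exists_eq_forall_mem_Icc_hasDerivWithinAt₀

/-- A solution of the Fokker–Planck equation on `[0, T]` with values in `P_o(G)`. -/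
def SolOn (ω : Fin n → Fin n → ℝ) (W : Matrix (Fin n) (Fin n) ℝ) (V : Fin n → ℝ) (β T : ℝ)
    (y : ℝ → Fin n → ℝ) : Prop :=
  ∀ t ∈ Set.Icc 0 T, PoG (y t) ∧ HasDerivWithinAt y (field ω W V β (y t)) (Set.Icc 0 T) t

section SolOn

variable {ω : Fin n → Fin n → ℝ} {W : Matrix (Fin n) (Fin n) ℝ} {V : Fin n → ℝ} {β T : ℝ}

lemma SolOn.mono {T' : ℝ} {y : ℝ → Fin n → ℝ} (h : SolOn ω W V β T y) (hT : T' ≤ T) :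
    SolOn ω W V β T' y := fun t ht =>
  have hsub := Set.Icc_subset_Icc_right hT
  ⟨(h t (hsub ht)).1, (h t (hsub ht)).2.mono hsub⟩

lemma IsSolution.solOn {y : ℝ → Fin n → ℝ} (h : IsSolution ω W V β y) (T : ℝ) :
    SolOn ω W V β T y := fun t ht =>
  ⟨h.1 t ht.1, (h.2 t ht.1).mono Set.Icc_subset_Ici_self⟩

lemma SolOn.continuousOn {y : ℝ → Fin n → ℝ} (h : SolOn ω W V β T y) :
    ContinuousOn y (Set.Icc 0 T) := fun t ht => (h t ht).2.continuousWithinAt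

lemma SolOn.exists_lower {y : ℝ → Fin n → ℝ} (h : SolOn ω W V β T y) :
    ∃ ε > 0, ∀ t ∈ Set.Icc 0 T, ∀ i, ε ≤ y t i := by
  have h1 : ∀ i, ∃ ε > 0, ∀ t ∈ Set.Icc 0 T, ε ≤ y t i := fun i =>
    isCompact_Icc.exists_forall_le' (continuousOn_pi.1 h.continuousOn i) fun t ht => (h t ht).1.2 i
  choose e he hle using h1
  obtain ⟨ε, hε, hεe⟩ : ∃ ε > 0, ∀ i, ε ≤ e i := by
    obtain ⟨ε, hε⟩ := Finite.exists_le fun i => (e i)⁻¹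
    refine ⟨(max ε 1)⁻¹, by positivity, fun i => inv_le_of_inv_le₀ (he i) ?_⟩
    exact (hε i).trans (le_max_left _ _)
  exact ⟨ε, hε, fun t ht i => (hεe i).trans (hle i t ht)⟩

lemma SolOn.unique (hω : ∀ i, ω i i = 0) {y z : ℝ → Fin n → ℝ} (hy : SolOn ω W V β T y)
    (hz : SolOn ω W V β T z) (h0 : y 0 = z 0) : Set.EqOn y z (Set.Icc 0 T) := by
  obtain ⟨ε₁, h₁, hy'⟩ := hy.exists_lower
  obtain ⟨ε₂, h₂, hz'⟩ := hz.exists_lower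
  obtain ⟨K, hK⟩ := exists_lipschitz_field (W := W) (V := V) (β := β) hω (lt_min h₁ h₂)
  have hder : ∀ u, SolOn ω W V β T u → ∀ t ∈ Set.Ico 0 T,
      HasDerivWithinAt u (field ω W V β (u t)) (Set.Ici t) t := fun u hu t ht =>
    (hu t (Set.Ico_subset_Icc_self ht)).2.mono_of_mem_nhdsWithin
      (mem_of_superset (Icc_mem_nhdsGE ht.2) (Set.Icc_subset_Icc_left ht.1))
  refine ODE_solution_unique_of_mem_Icc_right (v := fun _ => field ω W V β)
    (s := fun _ => Set.Icc (fun _ => min ε₁ ε₂) (fun _ => 1)) (K := K)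
    (fun _ _ => hK) hy.continuousOn (hder y hy) ?_ hz.continuousOn (hder z hz) ?_ h0
  · intro t ht
    have ht' := Set.Ico_subset_Icc_self ht
    exact ⟨fun i => (min_le_left _ _).trans (hy' t ht' i), (hy t ht').1.le_one⟩
  · intro t ht
    have ht' := Set.Ico_subset_Icc_self ht
    exact ⟨fun i => (min_le_right _ _).trans (hz' t ht' i), (hz t ht').1.le_one⟩

lemma exists_solOn (hG : IsGraph ω) (hβ : 0 < β) {ρ0 : Fin n → ℝ} (hρ0 : PoG ρ0)
    (hT : 0 ≤ T) : ∃ y : ℝ → Fin n → ℝ, y 0 = ρ0 ∧ SolOn ω W V β T y := by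
  obtain ⟨K₀, hK₀⟩ := exists_field_lower hG hβ W V
  set K := max K₀ 0
  have hKle : K₀ ≤ K := le_max_left _ _
  have hK : 0 ≤ K := le_max_right _ _
  obtain ⟨m, hm, hm1, hmρ⟩ : ∃ m > 0, m ≤ 1 ∧ ∀ i, m < ρ0 i := by
    obtain ⟨c, hc⟩ := Finite.exists_le fun i => (ρ0 i)⁻¹
    have hpos : (0:ℝ) < max c 0 + 1 := by positivity
    refine ⟨(max c 0 + 1)⁻¹, by positivity, inv_le_one_of_one_le₀ (by simp), fun i => ?_⟩
    refine inv_lt_of_inv_lt₀ (hρ0.2 i) ?_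
    linarith [hc i, le_max_left c 0]
  set b : ℝ → ℝ := fun t => m * Real.exp (-K * t) with hbdef
  have hbpos : ∀ t, 0 < b t := fun t => by positivity
  have hb : ∀ t, HasDerivAt b (-K * b t) t := fun t => by
    refine ((((hasDerivAt_id t).const_mul (-K)).exp).const_mul m).congr_deriv ?_
    simp only [hbdef, id_eq]
    ring
  have hbT : ∀ t ≤ T, b T ≤ b t := fun t ht => by
    simp only [hbdef]
    gcongr m * Real.exp ?_
    nlinarith
  have hεle : b T ≤ 1 := (hbT 0 hT).trans (by simpa [hbdef] using hm1)
  obtain ⟨Lip, hLip⟩ := exists_lipschitz_field (W := W) (V := V) (β := β) hG.2.1 (hbpos T)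
  obtain ⟨B, hB⟩ := isCompact_Icc.exists_bound_of_continuousOn hLip.continuousOn
  have hlip : LipschitzWith (Lip * 1) (fun x => field ω W V β (clamp (b T) x)) := by
    rw [← lipschitzOnWith_univ]
    exact hLip.comp (lipschitzWith_clamp _).lipschitzOnWith fun x _ => clamp_mem hεle x
  obtain ⟨y, hy0, hy⟩ := exists_solution_of_bounded (L := B.toNNReal) hlip
    (fun x => (hB _ (clamp_mem hεle x)).trans (Real.le_coe_toNNReal B)) ρ0 hT
  have hsum : ∀ t ∈ Set.Icc 0 T, ∑ i, y t i = 1 := by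
    intro t ht
    have hd : ∀ s ∈ Set.Icc 0 T, HasDerivWithinAt (fun s => ∑ i, y s i) 0 (Set.Icc 0 T) s := by
      intro s hs
      have h1 := HasDerivWithinAt.fun_sum fun i (_ : i ∈ Finset.univ) =>
        hasDerivWithinAt_pi.1 (hy s hs) i
      rwa [sum_field hG] at h1
    rw [constant_of_has_deriv_right_zero (fun s hs => (hd s hs).continuousWithinAt)
      (fun s hs => (hd s (Set.Ico_subset_Icc_self hs)).mono_of_mem_nhdsWithin
        (mem_of_superset (Icc_mem_nhdsGE hs.2) (Set.Icc_subset_Icc_left hs.1))) t ht, hy0, hρ0.1]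
  have hPoG : ∀ t ∈ Set.Icc 0 T, (∀ j, b t ≤ y t j) →
      PoG (y t) ∧ clamp (b T) (y t) = y t := by
    intro t ht hj
    have hp : PoG (y t) := ⟨hsum t ht, fun j => (hbpos t).trans_le (hj j)⟩
    exact ⟨hp, clamp_eq_self ⟨fun j => (hbT t ht.2).trans (hj j), hp.le_one⟩⟩
  have hbar := barrier hy hb (fun i => by simpa [hbdef, hy0] using hmρ i) fun t ht i hj hi => by
    obtain ⟨hp, hcl⟩ := hPoG t ht hj
    rw [hcl]
    have h1 := hK₀ (y t) hp i fun j => hi ▸ hj j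
    rw [hi] at h1
    nlinarith [hbpos t]
  refine ⟨y, hy0, fun t ht => ?_⟩
  obtain ⟨hp, hcl⟩ := hPoG t ht fun j => (hbar t ht j).le
  have h1 := hy t ht
  rw [hcl] at h1
  exact ⟨hp, h1⟩

end SolOn

/-- existence and uniqueness of solutions of the Fokker–Planck equation
on `[0,∞)` for every initial condition `ρ⁰ ∈ P_o(G)`. -/
theorem exists_unique_solution
    (n : ℕ) (hn : 2 ≤ n) (ω : Fin n → Fin n → ℝ) (hG : IsGraph ω)
    (W : Matrix (Fin n) (Fin n) ℝ) (hW : W.IsSymm) (V : Fin n → ℝ) (β : ℝ) (hβ : 0 < β)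
    (ρ0 : Fin n → ℝ) (hρ0 : PoG ρ0) :
    ∃ ρ : ℝ → Fin n → ℝ, (IsSolution ω W V β ρ ∧ ρ 0 = ρ0) ∧
      ∀ σ : ℝ → Fin n → ℝ, IsSolution ω W V β σ → σ 0 = ρ0 →
        ∀ t ∈ Set.Ici (0:ℝ), σ t = ρ t := by
  choose y hy0 hy using fun N : ℕ =>
    exists_solOn (W := W) (V := V) hG hβ hρ0 (T := N) (Nat.cast_nonneg N)
  have hglue : ∀ N : ℕ, ∀ t ∈ Set.Ico (0:ℝ) N, y (⌊t⌋₊ + 1) t = y N t := by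
    intro N t ht
    have hle : ⌊t⌋₊ + 1 ≤ N := (Nat.floor_lt ht.1).2 ht.2
    refine (hy (⌊t⌋₊ + 1)).unique hG.2.1 ((hy N).mono (by exact_mod_cast hle))
      ((hy0 _).trans (hy0 _).symm) ⟨ht.1, ?_⟩
    exact_mod_cast (Nat.lt_floor_add_one t).le
  have hmem : ∀ t ∈ Set.Ici (0:ℝ), t ∈ Set.Ico (0:ℝ) (⌊t⌋₊ + 1 : ℕ) := fun t ht =>
    ⟨ht, by exact_mod_cast Nat.lt_floor_add_one t⟩
  refine ⟨fun t => y (⌊t⌋₊ + 1) t, ⟨⟨fun t ht => ?_, fun t ht => ?_⟩, hy0 _⟩, ?_⟩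
  · exact (hy _ t (Set.Ico_subset_Icc_self (hmem t ht))).1
  · set N := ⌊t⌋₊ + 1
    have htN := hmem t ht
    have hnhds : Set.Ico (0:ℝ) N ∈ nhdsWithin t (Set.Ici 0) := by
      rw [← Set.Ici_inter_Iio]
      exact inter_mem_nhdsWithin _ (Iio_mem_nhds htN.2)
    refine ((hy N t (Set.Ico_subset_Icc_self htN)).2.mono_of_mem_nhdsWithin
      (mem_of_superset hnhds Set.Ico_subset_Icc_self)).congr_of_eventuallyEq ?_ rfl
    filter_upwards [hnhds] with s hs using hglue N s hs
  · intro σ hσ hσ0 t ht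
    exact (hσ.solOn _).unique hG.2.1 (hy (⌊t⌋₊ + 1)) (hσ0.trans (hy0 _).symm)
      (Set.Ico_subset_Icc_self (hmem t ht))

end FPEGraph
end
end

section
/- Assume there is λ > 0 with Hess𝓕(σ) ⪰ λ·I for all σ ∈ P_o(G). Then the Gibbs measure ρ∞ ∈ P_o(G) is unique, and for every initial condition ρ⁰ ∈ P_o(G), any continuously differentiable solution ρ : [0,∞) → P_o(G) of the Fokker–Planck equation ρ'(t) = −L(ρ(t))F(ρ(t)) with ρ(0) = ρ⁰ satisfies lim_{t→∞} ρ(t) = ρ∞. -/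
open Finset Filter Matrix
open scoped Classical

noncomputable section

namespace FPEGraph

variable {n : ℕ}

/-- The logarithmic mean is at most the arithmetic mean. -/
lemma sq_sub_div_half_add_le (a b : ℝ) (ha : 0 < a) (hb : 0 < b) :
    (a - b) ^ 2 * ((a + b) / 2)⁻¹ ≤ (Real.log a - Real.log b) * (a - b) := by
  wlog hab : b ≤ a generalizing a b
  · have := this b a hb ha (le_of_not_ge hab)
    rw [add_comm b a] at this
    nlinarith
  have h := Real.le_log_one_add_of_nonneg (x := a / b - 1)
    (by rw [sub_nonneg, le_div_iff₀ hb]; linarith)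
  rw [add_sub_cancel, Real.log_div ha.ne' hb.ne'] at h
  have e : 2 * (a / b - 1) / (a / b - 1 + 2) = (a - b) * ((a + b) / 2)⁻¹ := by
    have h1 : a / b - 1 = (a - b) / b := by field_simp
    have h2 : a / b - 1 + 2 = (a + b) / b := by field_simp; ring
    rw [h2, h1]
    field_simp
  rw [e] at h
  nlinarith [mul_le_mul_of_nonneg_right h (sub_nonneg.2 hab)]

/-- A lower bound on the Hessian makes the gradient strongly monotone. -/
lemma gradF_strongly_monotone {W : Matrix (Fin n) (Fin n) ℝ} {V : Fin n → ℝ} {β lam : ℝ}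
    (hβ : 0 < β)
    (hHess : ∀ σ : Fin n → ℝ, PoG σ → ∀ Φ : Fin n → ℝ,
      lam * (∑ i, (Φ i)^2) ≤ Φ ⬝ᵥ (hessF W β σ).mulVec Φ)
    {a b : Fin n → ℝ} (ha : PoG a) (hb : PoG b) :
    lam * ∑ i, (a i - b i) ^ 2 ≤ ∑ i, (gradF W V β a i - gradF W V β b i) * (a i - b i) := by
  have hmid : PoG fun i => (a i + b i) / 2 := by
    refine ⟨?_, fun i => by have := ha.2 i; have := hb.2 i; positivity⟩
    rw [← Finset.sum_div, Finset.sum_add_distrib, ha.1, hb.1]; norm_num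
  refine (hHess _ hmid (a - b)).trans ?_
  simp only [hessF, add_mulVec, dotProduct, smul_mulVec, mulVec_diagonal, Pi.add_apply,
    Pi.smul_apply, smul_eq_mul, Pi.sub_apply]
  refine Finset.sum_le_sum fun i _ => ?_
  have h := mul_le_mul_of_nonneg_left (sq_sub_div_half_add_le _ _ (ha.2 i) (hb.2 i)) hβ.le
  simp only [gradF, mulVec_sub, Pi.sub_apply]
  nlinarith

/-- Gibbs measures are the critical points of the free energy on the simplex. -/
lemma isGibbs_iff [NeZero n] {W : Matrix (Fin n) (Fin n) ℝ} {V : Fin n → ℝ} {β : ℝ} (hβ : 0 < β)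
    {ρ : Fin n → ℝ} (hρ : PoG ρ) :
    IsGibbs W V β ρ ↔ ∀ i j, gradF W V β ρ i = gradF W V β ρ j := by
  have hK : 0 < ∑ j, Real.exp (-(W.mulVec ρ j + V j) / β) :=
    Finset.sum_pos (fun _ _ => Real.exp_pos _) Finset.univ_nonempty
  constructor
  · intro h
    have key : ∀ i, gradF W V β ρ i =
        β - β * Real.log (∑ j, Real.exp (-(W.mulVec ρ j + V j) / β)) := by
      intro i
      have h1 := congrArg Real.log (h.2 i)
      rw [Real.log_div (Real.exp_ne_zero _) hK.ne', Real.log_exp] at h1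
      rw [gradF, h1]
      field_simp
      ring
    intro i j
    rw [key, key]
  · intro h
    refine ⟨hρ, fun i => ?_⟩
    set c := gradF W V β ρ i
    have key : ∀ j, Real.exp (-(W.mulVec ρ j + V j) / β) = ρ j * Real.exp (1 - c / β) := by
      intro j
      have hj : c = V j + W.mulVec ρ j + β * Real.log (ρ j) + β := h i j
      calc _ = Real.exp (Real.log (ρ j) + (1 - c / β)) := ?_
        _ = _ := by rw [Real.exp_add, Real.exp_log (hρ.2 j)]
      rw [hj]
      congr 1
      field_simp
      ring
    simp only [key]
    rw [← Finset.sum_mul, hρ.1, one_mul, mul_div_cancel_right₀ _ (Real.exp_ne_zero _)]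

lemma IsGibbs.unique [NeZero n] {W : Matrix (Fin n) (Fin n) ℝ} {V : Fin n → ℝ} {β lam : ℝ}
    (hβ : 0 < β) (hlam : 0 < lam)
    (hHess : ∀ σ : Fin n → ℝ, PoG σ → ∀ Φ : Fin n → ℝ,
      lam * (∑ i, (Φ i)^2) ≤ Φ ⬝ᵥ (hessF W β σ).mulVec Φ)
    {a b : Fin n → ℝ} (ha : IsGibbs W V β a) (hb : IsGibbs W V β b) : a = b := by
  have h := gradF_strongly_monotone (V := V) hβ hHess ha.1 hb.1
  have h0 : ∑ i, (gradF W V β a i - gradF W V β b i) * (a i - b i) = 0 := by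
    rw [Finset.sum_congr rfl fun i _ => by
      rw [(isGibbs_iff hβ ha.1).1 ha i 0, (isGibbs_iff hβ hb.1).1 hb i 0]]
    rw [← Finset.mul_sum, Finset.sum_sub_distrib, ha.1.1, hb.1.1, sub_self, mul_zero]
  rw [h0] at h
  have h1 : ∑ i, (a i - b i) ^ 2 = 0 :=
    le_antisymm (nonpos_of_mul_nonpos_right h hlam) (Finset.sum_nonneg fun i _ => sq_nonneg _)
  funext i
  have := (Finset.sum_eq_zero_iff_of_nonneg fun i _ => sq_nonneg (a i - b i)).1 h1 i
    (Finset.mem_univ i)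
  exact sub_eq_zero.1 (pow_eq_zero_iff two_ne_zero |>.1 this)

lemma continuous_freeEnergy (W : Matrix (Fin n) (Fin n) ℝ) (V : Fin n → ℝ) (β : ℝ) :
    Continuous (freeEnergy W V β) := by
  have h : ∀ i : Fin n, Continuous fun ρ : Fin n → ℝ => ρ i * Real.log (ρ i) :=
    fun i => Real.continuous_mul_log.comp (continuous_apply i)
  unfold freeEnergy mulVec dotProduct
  fun_prop

lemma hasDerivAt_freeEnergy {W : Matrix (Fin n) (Fin n) ℝ} (hW : W.IsSymm) (V : Fin n → ℝ)
    (β : ℝ) {γ : ℝ → Fin n → ℝ} {v : Fin n → ℝ} {t : ℝ} (hγ : HasDerivAt γ v t)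
    (hpos : ∀ i, γ t i ≠ 0) :
    HasDerivAt (fun s => freeEnergy W V β (γ s)) (∑ i, gradF W V β (γ t) i * v i) t := by
  have hc := hasDerivAt_pi.1 hγ
  have h1 : HasDerivAt (fun s => γ s ⬝ᵥ W.mulVec (γ s))
      (∑ i, (v i * W.mulVec (γ t) i + γ t i * W.mulVec v i)) t := by
    unfold dotProduct
    refine HasDerivAt.fun_sum fun i _ => (hc i).mul ?_
    unfold mulVec dotProduct
    exact HasDerivAt.fun_sum fun j _ => (hc j).const_mul _
  have h2 : HasDerivAt (fun s => V ⬝ᵥ γ s) (∑ i, V i * v i) t := by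
    unfold dotProduct
    exact HasDerivAt.fun_sum fun j _ => (hc j).const_mul _
  have h3 : HasDerivAt (fun s => ∑ i, γ s i * Real.log (γ s i))
      (∑ i, (Real.log (γ t i) + 1) * v i) t :=
    HasDerivAt.fun_sum fun i _ => 
      HasDerivAt.comp (h₂ := fun x => x * Real.log x) t (Real.hasDerivAt_mul_log (hpos i)) (hc i)
  have hsymm : ∑ i, γ t i * W.mulVec v i = ∑ i, v i * W.mulVec (γ t) i := by
    change γ t ⬝ᵥ W *ᵥ v = v ⬝ᵥ W *ᵥ γ t
    rw [dotProduct_mulVec, ← mulVec_transpose, hW.eq, dotProduct_comm]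
  refine (((h1.const_mul (1 / 2)).add h2).add (h3.const_mul β)).congr_deriv ?_
  rw [Finset.sum_add_distrib, hsymm, ← two_mul, ← mul_assoc, Finset.mul_sum, Finset.mul_sum,
    ← Finset.sum_add_distrib, ← Finset.sum_add_distrib]
  refine Finset.sum_congr rfl fun i _ => ?_
  simp only [gradF]
  ring

lemma PoG.toPG {ρ : Fin n → ℝ} (h : PoG ρ) : PG ρ := ⟨h.1, fun i => (h.2 i).le⟩

lemma isCompact_setOf_PG : IsCompact {ρ : Fin n → ℝ | PG ρ} := by
  convert isCompact_stdSimplex ℝ (Fin n) using 1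
  ext ρ
  exact and_comm

/-- The entropy has infinite slope at the boundary, so minimizers of the free energy are
interior. -/
lemma PoG_of_isMinOn [NeZero n] {W : Matrix (Fin n) (Fin n) ℝ} {V : Fin n → ℝ} {β : ℝ}
    (hβ : 0 < β) {ρ : Fin n → ℝ} (hρ : PG ρ)
    (hmin : IsMinOn (freeEnergy W V β) {ρ | PG ρ} ρ) : PoG ρ := by
  refine ⟨hρ.1, fun i₀ => (hρ.2 i₀).lt_of_ne' fun h0 => ?_⟩
  have hn : (0 : ℝ) < n := by exact_mod_cast NeZero.pos n
  set u : Fin n → ℝ := fun _ => (n : ℝ)⁻¹ with hu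
  set η : ℝ → ℝ := fun x => x * Real.log x
  have hη : ConvexOn ℝ (Set.Ici 0) η := Real.convexOn_mul_log
  set d : Fin n → ℝ := u - ρ
  set A := (1 / 2) * (ρ ⬝ᵥ W.mulVec d + d ⬝ᵥ W.mulVec ρ) + V ⬝ᵥ d
    + β * (∑ i, η (u i) - ∑ i, η (ρ i))
  set B := (1 / 2) * (d ⬝ᵥ W.mulVec d)
  have key : ∀ s : ℝ, 0 < s → s < 1 → 0 ≤ A + s * B + β * ((n : ℝ)⁻¹ * Real.log s) := by
    intro s hs hs1
    have hmem : PG (ρ + s • d) := by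
      constructor
      · have : ∑ i, d i = 0 := by simp [d, hu, hρ.1, hn.ne']
        simp [Finset.sum_add_distrib, ← Finset.mul_sum, this, hρ.1]
      · intro i
        have := hρ.2 i
        have h2 : 0 ≤ s * (n : ℝ)⁻¹ := by positivity
        simp only [Pi.add_apply, Pi.smul_apply, smul_eq_mul, d, hu, Pi.sub_apply]
        nlinarith
    have hent : ∑ i, η ((ρ + s • d) i) ≤
        ∑ i, ((1 - s) * η (ρ i) + s * η (u i) +
          if i = i₀ then s * ((n : ℝ)⁻¹ * Real.log s) else 0) := by
      refine Finset.sum_le_sum fun i _ => ?_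
      have e : (ρ + s • d) i = (1 - s) * ρ i + s * u i := by simp [d]; ring
      rw [e]
      split_ifs with hi
      · rw [hi, h0]
        simp only [η, hu, mul_zero, zero_add, zero_mul]
        rw [Real.log_mul hs.ne' (inv_pos.2 hn).ne']
        apply le_of_eq
        ring
      · rw [add_zero]
        exact hη.2 (hρ.2 i) (inv_pos.2 hn).le (by linarith) hs.le (by ring)
    rw [Finset.sum_add_distrib, Finset.sum_add_distrib, ← Finset.mul_sum, ← Finset.mul_sum,
      Finset.sum_ite_eq' Finset.univ i₀, if_pos (Finset.mem_univ _)] at hent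
    have hle : freeEnergy W V β ρ ≤ freeEnergy W V β (ρ + s • d) := hmin hmem
    simp only [freeEnergy, mulVec_add, mulVec_smul, dotProduct_add, add_dotProduct,
      smul_dotProduct, dotProduct_smul, smul_eq_mul] at hle
    have hent' := mul_le_mul_of_nonneg_left hent hβ.le
    have : 0 ≤ s * (A + s * B + β * ((n : ℝ)⁻¹ * Real.log s)) := by
      simp only [A, B, η] at *
      nlinarith
    exact nonneg_of_mul_nonneg_right this hs
  have hlim : Tendsto (fun s : ℝ => (A + s * B) + β * ((n : ℝ)⁻¹ * Real.log s))
      (nhdsWithin 0 (Set.Ioi 0)) atBot := by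
    have h1 : Tendsto (fun s : ℝ => A + s * B) (nhdsWithin 0 (Set.Ioi 0)) (nhds (A + 0 * B)) :=
      ((by fun_prop : Continuous fun s : ℝ => A + s * B).tendsto 0).mono_left
        nhdsWithin_le_nhds
    exact h1.add_atBot ((Real.tendsto_log_nhdsGT_zero.const_mul_atBot
      (inv_pos.2 hn)).const_mul_atBot hβ)
  obtain ⟨s, hs, hs1⟩ := ((hlim.eventually (eventually_lt_atBot 0)).and
    (Ioo_mem_nhdsGT (zero_lt_one' ℝ))).exists
  exact (key s hs1.1 hs1.2).not_gt hs

/-- Minimizers of the free energy on the simplex are Gibbs measures. -/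
lemma isGibbs_of_isMinOn [NeZero n] {W : Matrix (Fin n) (Fin n) ℝ} (hW : W.IsSymm)
    {V : Fin n → ℝ} {β : ℝ} (hβ : 0 < β) {ρ : Fin n → ℝ} (hρ : PG ρ)
    (hmin : IsMinOn (freeEnergy W V β) {ρ | PG ρ} ρ) : IsGibbs W V β ρ := by
  have hpos := PoG_of_isMinOn hβ hρ hmin
  refine (isGibbs_iff hβ hpos).2 fun i j => ?_
  set d : Fin n → ℝ := Pi.single i 1 - Pi.single j 1
  have hd : HasDerivAt (fun s : ℝ => ρ + s • d) d 0 := by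
    simpa using ((hasDerivAt_id (0 : ℝ)).smul_const d).const_add ρ
  have hE := hasDerivAt_freeEnergy hW V β hd (by simpa using fun k => (hpos.2 k).ne')
  have hloc : IsLocalMin (fun s : ℝ => freeEnergy W V β (ρ + s • d)) 0 := by
    have hev : ∀ᶠ s : ℝ in nhds 0, ∀ k, 0 < (ρ + s • d) k := by
      refine eventually_all.2 fun k => ?_
      have hc : Continuous fun s : ℝ => (ρ + s • d) k := by
        simp only [Pi.add_apply, Pi.smul_apply]; fun_prop
      exact (hc.tendsto 0).eventually_const_lt (by simpa using hpos.2 k)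
    filter_upwards [hev] with s hs
    simp only [zero_smul, add_zero]
    refine hmin ⟨?_, fun k => (hs k).le⟩
    have : ∑ k, d k = 0 := by simp [d]
    simp [Finset.sum_add_distrib, ← Finset.mul_sum, this, hρ.1]
  have h0 := hloc.hasDerivAt_eq_zero hE
  simp only [zero_smul, add_zero, d, Pi.sub_apply, mul_sub, Finset.sum_sub_distrib,
    Pi.single_apply, mul_ite, mul_one, mul_zero, Finset.sum_ite_eq', Finset.mem_univ,
    if_true] at h0
  linarith

lemma Lmat_mulVec {ω : Fin n → Fin n → ℝ} (hω : ∀ i, ω i i = 0) (ρ Φ : Fin n → ℝ) (i : Fin n) :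
    (Lmat ω ρ).mulVec Φ i = ∑ j, ω i j * theta ρ i j * (Φ i - Φ j) := by
  have h : ∀ j, Lmat ω ρ i j * Φ j =
      (if i = j then (∑ k, ω i k * theta ρ i k) * Φ i else 0) - ω i j * theta ρ i j * Φ j := by
    intro j
    unfold Lmat
    split_ifs with hij
    · subst hij; simp [hω]
    · ring
  simp only [mulVec, dotProduct, h, Finset.sum_sub_distrib, mul_sub]
  rw [Finset.sum_ite_eq, if_pos (Finset.mem_univ _), Finset.sum_mul]

/-- The Dirichlet form of the weighted graph Laplacian. -/
lemma sum_mul_Lmat_mulVec {ω : Fin n → Fin n → ℝ} (hs : ∀ i j, ω i j = ω j i)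
    (hω : ∀ i, ω i i = 0) (ρ Φ : Fin n → ℝ) :
    ∑ i, Φ i * (Lmat ω ρ).mulVec Φ i =
      (1 / 2) * ∑ i, ∑ j, ω i j * theta ρ i j * (Φ i - Φ j) ^ 2 := by
  simp only [Lmat_mulVec hω, Finset.mul_sum]
  have h : ∑ i, ∑ j, Φ i * (ω i j * theta ρ i j * (Φ i - Φ j)) =
      ∑ i, ∑ j, Φ j * (ω i j * theta ρ i j * (Φ j - Φ i)) := by
    rw [Finset.sum_comm]
    refine Finset.sum_congr rfl fun i _ => Finset.sum_congr rfl fun j _ => ?_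
    rw [hs j i]; unfold theta; ring
  have h2 : ∑ i, ∑ j, 1 / 2 * (ω i j * theta ρ i j * (Φ i - Φ j) ^ 2) =
      (1 / 2) * (∑ i, ∑ j, Φ i * (ω i j * theta ρ i j * (Φ i - Φ j)) +
        ∑ i, ∑ j, Φ j * (ω i j * theta ρ i j * (Φ j - Φ i))) := by
    simp only [← Finset.sum_add_distrib, Finset.mul_sum]
    refine Finset.sum_congr rfl fun i _ => Finset.sum_congr rfl fun j _ => ?_
    ring
  rw [h2, ← h]
  ring

/-- Rate of dissipation of the free energy along the Fokker–Planck equation. -/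
def dissipation (ω : Fin n → Fin n → ℝ) (W : Matrix (Fin n) (Fin n) ℝ) (V : Fin n → ℝ)
    (β : ℝ) (ρ : Fin n → ℝ) : ℝ :=
  (1 / 2) * ∑ i, ∑ j, ω i j * theta ρ i j * (gradF W V β ρ i - gradF W V β ρ j) ^ 2

lemma edge_dissipation_nonneg {ω : Fin n → Fin n → ℝ} (hG : IsGraph ω) {ρ : Fin n → ℝ}
    (hρ : PG ρ) (Φ : Fin n → ℝ) (i j : Fin n) :
    0 ≤ ω i j * theta ρ i j * (Φ i - Φ j) ^ 2 := by
  have := hρ.2 i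
  have := hρ.2 j
  have := hG.2.2.1 i j
  unfold theta
  positivity

lemma dissipation_nonneg {ω : Fin n → Fin n → ℝ} (hG : IsGraph ω)
    (W : Matrix (Fin n) (Fin n) ℝ) (V : Fin n → ℝ) (β : ℝ) {ρ : Fin n → ℝ} (hρ : PG ρ) :
    0 ≤ dissipation ω W V β ρ :=
  mul_nonneg (by norm_num) (Finset.sum_nonneg fun i _ => Finset.sum_nonneg fun j _ =>
    edge_dissipation_nonneg hG hρ _ i j)

lemma edge_dissipation_le {ω : Fin n → Fin n → ℝ} (hG : IsGraph ω)
    (W : Matrix (Fin n) (Fin n) ℝ) (V : Fin n → ℝ) (β : ℝ) {ρ : Fin n → ℝ} (hρ : PG ρ)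
    (i j : Fin n) :
    ω i j * theta ρ i j * (gradF W V β ρ i - gradF W V β ρ j) ^ 2 ≤
      2 * dissipation ω W V β ρ := by
  have h := edge_dissipation_nonneg hG hρ (gradF W V β ρ)
  have h1 := Finset.single_le_sum (fun k _ => h i k) (Finset.mem_univ j)
  have h2 := Finset.single_le_sum (fun k _ => Finset.sum_nonneg (s := Finset.univ) fun l _ => h k l)
    (Finset.mem_univ i)
  unfold dissipation
  linarith

/-- Along a sequence of vanishing dissipation, limit points are Gibbs measures. -/
lemma isGibbs_of_tendsto_dissipation [NeZero n] {ω : Fin n → Fin n → ℝ} (hG : IsGraph ω)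
    {W : Matrix (Fin n) (Fin n) ℝ} {V : Fin n → ℝ} {β : ℝ} (hβ : 0 < β)
    {x : ℕ → Fin n → ℝ} (hx : ∀ k, PoG (x k)) {ρ : Fin n → ℝ} (hρ : PG ρ)
    (hlim : Tendsto x atTop (nhds ρ))
    (hdis : Tendsto (fun k => dissipation ω W V β (x k)) atTop (nhds 0)) :
    IsGibbs W V β ρ := by
  have hc : ∀ i, Tendsto (fun k => x k i) atTop (nhds (ρ i)) := tendsto_pi_nhds.1 hlim
  have hedge : ∀ i j, Tendsto (fun k => ω i j * theta (x k) i j *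
      (gradF W V β (x k) i - gradF W V β (x k) j) ^ 2) atTop (nhds 0) := by
    intro i j
    refine squeeze_zero (fun k => edge_dissipation_nonneg hG (hx k).toPG _ i j)
      (fun k => edge_dissipation_le hG W V β (hx k).toPG i j) ?_
    simpa using hdis.const_mul 2
  have hθ : ∀ i j, Tendsto (fun k => ω i j * theta (x k) i j) atTop
      (nhds (ω i j * theta ρ i j)) :=
    fun i j => (((hc i).add (hc j)).div_const 2).const_mul _
  have hlin : ∀ i, Tendsto (fun k => V i + W.mulVec (x k) i) atTop
      (nhds (V i + W.mulVec ρ i)) := fun i =>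
    (((continuous_apply i).comp (continuous_const.matrix_mulVec continuous_id)).tendsto ρ
      |>.comp hlim).const_add _
  have hgrad : ∀ i, 0 < ρ i →
      Tendsto (fun k => gradF W V β (x k) i) atTop (nhds (gradF W V β ρ i)) := fun i hi =>
    ((hlin i).add (((hc i).log hi.ne').const_mul β)).add_const β
  have hprop : ∀ i j, ω i j ≠ 0 → 0 < ρ i → 0 < ρ j := by
    intro i j hij hi
    refine (hρ.2 j).lt_of_ne' fun hj => ?_
    have hlog : Tendsto (fun k => Real.log (x k j)) atTop atBot := by
      refine Real.tendsto_log_nhdsGT_zero.comp (tendsto_nhdsWithin_iff.2 ⟨?_, ?_⟩)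
      · simpa [hj] using hc j
      · exact Eventually.of_forall fun k => (hx k).2 j
    have hgj : Tendsto (fun k => gradF W V β (x k) j) atTop atBot :=
      tendsto_atBot_add_const_right _ _ ((hlin j).add_atBot (hlog.const_mul_atBot hβ))
    have hdiff : Tendsto (fun k => gradF W V β (x k) i - gradF W V β (x k) j) atTop atTop := by
      simpa only [sub_eq_add_neg, Function.comp_def] using
        (hgrad i hi).add_atTop (tendsto_neg_atBot_atTop.comp hgj)
    have hpos : 0 < ω i j * theta ρ i j := by
      have := (hG.2.2.1 i j).lt_of_ne' hij
      have := hρ.2 j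
      unfold theta
      positivity
    exact not_tendsto_nhds_of_tendsto_atTop ((hθ i j).pos_mul_atTop hpos
      ((tendsto_pow_atTop two_ne_zero).comp hdiff)) 0 (hedge i j)
  obtain ⟨i₀, hi₀⟩ : ∃ i, 0 < ρ i := by
    by_contra! h
    have := Finset.sum_nonpos fun i (_ : i ∈ Finset.univ) => h i
    linarith [hρ.1]
  have hpos : PoG ρ := by
    refine ⟨hρ.1, fun j => ?_⟩
    have hpath := hG.2.2.2 i₀ j
    induction hpath with
    | refl => exact hi₀
    | tail _ hbc ih => exact hprop _ _ hbc ih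
  refine (isGibbs_iff hβ hpos).2 fun i j => ?_
  have hpath := hG.2.2.2 i j
  induction hpath with
  | refl => rfl
  | @tail b c _ hbc ih =>
    rw [ih]
    have h := tendsto_nhds_unique (hedge b c)
      ((hθ b c).mul (((hgrad b (hpos.2 b)).sub (hgrad c (hpos.2 c))).pow 2))
    have hb := hpos.2 b
    have hc' := hpos.2 c
    have hne : ω b c * theta ρ b c ≠ 0 := mul_ne_zero hbc (by unfold theta; positivity)
    have := (mul_eq_zero.1 h.symm).resolve_left hne
    exact sub_eq_zero.1 (pow_eq_zero_iff two_ne_zero |>.1 this)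

lemma IsSolution.hasDerivAt_freeEnergy {ω : Fin n → Fin n → ℝ} (hG : IsGraph ω)
    {W : Matrix (Fin n) (Fin n) ℝ} (hW : W.IsSymm) {V : Fin n → ℝ} {β : ℝ}
    {ρ : ℝ → Fin n → ℝ} (hρ : IsSolution ω W V β ρ) {t : ℝ} (ht : 0 < t) :
    HasDerivAt (fun s => freeEnergy W V β (ρ s)) (-dissipation ω W V β (ρ t)) t := by
  have h := FPEGraph.hasDerivAt_freeEnergy hW V β
    ((hρ.2 t ht.le).hasDerivAt (Ici_mem_nhds ht)) fun i => ((hρ.1 t ht.le).2 i).ne'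
  simpa only [dissipation, Pi.neg_apply, mul_neg, Finset.sum_neg_distrib,
    sum_mul_Lmat_mulVec hG.1 hG.2.1] using h

lemma IsSolution.continuousOn_freeEnergy {ω : Fin n → Fin n → ℝ}
    {W : Matrix (Fin n) (Fin n) ℝ} {V : Fin n → ℝ} {β : ℝ}
    {ρ : ℝ → Fin n → ℝ} (hρ : IsSolution ω W V β ρ) :
    ContinuousOn (fun s => freeEnergy W V β (ρ s)) (Set.Ici 0) :=
  (continuous_freeEnergy W V β).comp_continuousOn fun t ht => (hρ.2 t ht).continuousWithinAt

/-- The free energy decreases along solutions. -/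
lemma IsSolution.antitoneOn_freeEnergy {ω : Fin n → Fin n → ℝ} (hG : IsGraph ω)
    {W : Matrix (Fin n) (Fin n) ℝ} (hW : W.IsSymm) {V : Fin n → ℝ} {β : ℝ}
    {ρ : ℝ → Fin n → ℝ} (hρ : IsSolution ω W V β ρ) :
    AntitoneOn (fun s => freeEnergy W V β (ρ s)) (Set.Ici 0) := by
  refine antitoneOn_of_hasDerivWithinAt_nonpos (convex_Ici 0) hρ.continuousOn_freeEnergy
    (f' := fun t => -dissipation ω W V β (ρ t)) ?_ ?_ <;>
    rw [interior_Ici] <;> intro t ht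
  · exact (hρ.hasDerivAt_freeEnergy hG hW ht).hasDerivWithinAt
  · exact neg_nonpos.2 (dissipation_nonneg hG W V β (hρ.1 t (Set.mem_Ioi.1 ht).le).toPG)

/-- The free energy along a solution tends to its value at some Gibbs measure. -/
lemma IsSolution.exists_isGibbs_tendsto_freeEnergy [NeZero n] {ω : Fin n → Fin n → ℝ}
    (hG : IsGraph ω) {W : Matrix (Fin n) (Fin n) ℝ} (hW : W.IsSymm) {V : Fin n → ℝ} {β : ℝ}
    (hβ : 0 < β) {ρ : ℝ → Fin n → ℝ} (hρ : IsSolution ω W V β ρ) {m : ℝ}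
    (hm : ∀ σ, PG σ → m ≤ freeEnergy W V β σ) :
    ∃ g, IsGibbs W V β g ∧
      Tendsto (fun t => freeEnergy W V β (ρ t)) atTop (nhds (freeEnergy W V β g)) := by
  obtain ⟨l, hl⟩ : ∃ l, Tendsto (fun t => freeEnergy W V β (ρ t)) atTop (nhds l) := by
    have hanti : Antitone fun t => freeEnergy W V β (ρ (max t 0)) := fun s t hst =>
      hρ.antitoneOn_freeEnergy hG hW (le_max_right s 0) (le_max_right t 0)
        (max_le_max_right 0 hst)
    have hbdd : BddBelow (Set.range fun t => freeEnergy W V β (ρ (max t 0))) :=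
      ⟨m, by rintro _ ⟨t, rfl⟩; exact hm _ (hρ.1 _ (le_max_right t 0)).toPG⟩
    refine ⟨_, (tendsto_atTop_ciInf hanti hbdd).congr' ?_⟩
    filter_upwards [eventually_ge_atTop 0] with t ht
    rw [max_eq_left ht]
  have hmvt : ∀ k : ℕ, ∃ t : ℝ, (k : ℝ) < t ∧ -dissipation ω W V β (ρ t) =
      freeEnergy W V β (ρ (k + 1)) - freeEnergy W V β (ρ k) := by
    intro k
    have hk : (0 : ℝ) ≤ k := k.cast_nonneg
    obtain ⟨t, ht, h⟩ := exists_hasDerivAt_eq_slope (fun s => freeEnergy W V β (ρ s))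
      (fun t => -dissipation ω W V β (ρ t)) (lt_add_one (k : ℝ))
      (hρ.continuousOn_freeEnergy.mono fun s hs => hk.trans hs.1)
      fun s hs => hρ.hasDerivAt_freeEnergy hG hW (hk.trans_lt hs.1)
    exact ⟨t, ht.1, by simpa using h⟩
  choose t ht hdt using hmvt
  have ht0 : ∀ k, 0 ≤ t k := fun k => (Nat.cast_nonneg k).trans (ht k).le
  have httop : Tendsto t atTop atTop :=
    tendsto_atTop_mono (fun k => (ht k).le) tendsto_natCast_atTop_atTop
  have hdis : Tendsto (fun k => dissipation ω W V β (ρ (t k))) atTop (nhds 0) := by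
    have h := (hl.comp tendsto_natCast_atTop_atTop).sub
      (hl.comp (tendsto_atTop_add_const_right atTop (1 : ℝ) tendsto_natCast_atTop_atTop))
    rw [sub_self] at h
    refine h.congr fun k => ?_
    have := hdt k
    simp only [Function.comp_apply]
    linarith
  obtain ⟨g, hg, φ, hφ, hconv⟩ := isCompact_setOf_PG.tendsto_subseq
    fun k => (hρ.1 (t k) (ht0 k)).toPG
  refine ⟨g, isGibbs_of_tendsto_dissipation hG hβ (fun k => hρ.1 _ (ht0 (φ k))) hg hconv
    (hdis.comp hφ.tendsto_atTop), ?_⟩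
  rwa [tendsto_nhds_unique (((continuous_freeEnergy W V β).tendsto g).comp hconv)
    (hl.comp (httop.comp hφ.tendsto_atTop))]

/-- if `Hess𝓕 ⪰ λ I` on `P_o(G)` then the Gibbs measure is unique and every
solution of the Fokker–Planck equation converges to it. -/
theorem gibbs_unique_and_convergence
    (n : ℕ) (hn : 2 ≤ n) (ω : Fin n → Fin n → ℝ) (hG : IsGraph ω)
    (W : Matrix (Fin n) (Fin n) ℝ) (hW : W.IsSymm) (V : Fin n → ℝ) (β : ℝ) (hβ : 0 < β)
    (lam : ℝ) (hlam : 0 < lam)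
    (hHess : ∀ σ : Fin n → ℝ, PoG σ → ∀ Φ : Fin n → ℝ,
      lam * (∑ i, (Φ i)^2) ≤ Φ ⬝ᵥ (hessF W β σ).mulVec Φ) :
    ∃ ρinf : Fin n → ℝ, IsGibbs W V β ρinf ∧
      (∀ g : Fin n → ℝ, IsGibbs W V β g → g = ρinf) ∧
      ∀ (ρ0 : Fin n → ℝ) (ρ : ℝ → Fin n → ℝ), PoG ρ0 →
        IsSolution ω W V β ρ → ρ 0 = ρ0 → Tendsto ρ atTop (nhds ρinf) := by
  have : NeZero n := ⟨by omega⟩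
  have hne : {ρ : Fin n → ℝ | PG ρ}.Nonempty :=
    ⟨Pi.single 0 1, by simp, fun i => by
      rw [Pi.single_apply]; split_ifs <;> norm_num⟩
  obtain ⟨g, hg, hmin⟩ := isCompact_setOf_PG.exists_isMinOn hne
    (continuous_freeEnergy W V β).continuousOn
  have hgibbs := isGibbs_of_isMinOn hW hβ hg hmin
  refine ⟨g, hgibbs, fun g' hg' => hg'.unique hβ hlam hHess hgibbs, ?_⟩
  intro ρ0 ρ _ hρ _
  obtain ⟨g', hg', hlim⟩ := hρ.exists_isGibbs_tendsto_freeEnergy hG hW hβ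
    fun σ hσ => hmin hσ
  rw [hg'.unique hβ hlam hHess hgibbs] at hlim
  refine isCompact_setOf_PG.tendsto_nhds_of_unique_mapClusterPt
    ((eventually_ge_atTop 0).mono fun t ht => (hρ.1 t ht).toPG) fun σ hσ hcl => ?_
  have hE : freeEnergy W V β σ = freeEnergy W V β g :=
    eq_of_nhds_neBot ((hcl.continuousAt_comp
      (continuous_freeEnergy W V β).continuousAt).clusterPt.mono hlim)
  have hσmin : IsMinOn (freeEnergy W V β) {ρ | PG ρ} σ := fun τ hτ => hE.trans_le (hmin hτ)
  exact (isGibbs_of_isMinOn hW hβ hσ hσmin).unique hβ hlam hHess hgibbs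

end FPEGraph
end
end
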